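/- arXiv:0909.0029 — 11 statements merged into one kernel-verified Lean document; each statement's English description precedes it below -/
import Mathlib

section
/- Let f_0 : ℤ → ℕ be finitely supported with support contained in the even integers or in the odd integers, let f_t evolve under the liar machine, and let g_t evolve under the linear machine with g_0 equal to f_0 (viewed as a function ℤ → ℝ). Then for every integer t ≥ 2 and every j ∈ ℤ, |f_t(j) − g_t(j)| < 12·log t, where log denotes the natural logarithm. -/
/-- The tie-breaking sign function of the liar machine: `χ(j) = 0` if `f j` is even,
and `χ(j) = (-1)^{#{i < j : f i odd}}` if `f j` is odd. -/
noncomputable def liarChi (f : ℤ → ℕ) (j : ℤ) : ℤ :=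
  if Odd (f j) then (-1 : ℤ) ^ ({i : ℤ | i < j ∧ Odd (f i)}.ncard) else 0

/-- `F` is an evolution of the liar machine:
`f_{t+1}(j) = (f_t(j-1) + f_t(j+1) + χ_t(j-1) - χ_t(j+1)) / 2`. -/
def IsLiarEvolution (F : ℕ → ℤ → ℕ) : Prop :=
  ∀ t j, (F (t + 1) j : ℤ) * 2 =
    (F t (j - 1) : ℤ) + (F t (j + 1) : ℤ) + liarChi (F t) (j - 1) - liarChi (F t) (j + 1)

/-- `G` is an evolution of the linear machine: `g_{t+1}(j) = (g_t(j-1) + g_t(j+1)) / 2`. -/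
def IsLinearEvolution (G : ℕ → ℤ → ℝ) : Prop :=
  ∀ t j, G (t + 1) j = (G t (j - 1) + G t (j + 1)) / 2

noncomputable def itL : ℕ → (ℤ → ℝ) → ℤ → ℝ
  | 0, u, j => u j
  | n + 1, u, j => (itL n u (j - 1) + itL n u (j + 1)) / 2

lemma itL_add (n : ℕ) : ∀ (u v : ℤ → ℝ) (j : ℤ),
    itL n (fun x => u x + v x) j = itL n u j + itL n v j := by
  induction n with
  | zero => intro u v j; simp [itL]
  | succ n ih => intro u v j; simp only [itL, ih]; ring

lemma itL_smul (n : ℕ) : ∀ (c : ℝ) (u : ℤ → ℝ) (j : ℤ),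
    itL n (fun x => c * u x) j = c * itL n u j := by
  induction n with
  | zero => intro c u j; simp [itL]
  | succ n ih => intro c u j; simp only [itL, ih]; ring

lemma itL_step (n : ℕ) : ∀ (u : ℤ → ℝ) (j : ℤ),
    itL n (fun x => (u (x - 1) + u (x + 1)) / 2) j = itL (n + 1) u j := by
  induction n with
  | zero => intro u j; simp [itL]
  | succ n ih =>
    intro u j
    rw [itL, ih, ih]
    rfl

lemma itL_mono (n : ℕ) : ∀ (u v : ℤ → ℝ) (_ : ∀ x, u x ≤ v x) (j : ℤ),
    itL n u j ≤ itL n v j := by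
  induction n with
  | zero => intro u v h j; exact h j
  | succ n ih => intro u v h j; simp only [itL]; linarith [ih u v h (j - 1), ih u v h (j + 1)]

lemma itL_sq (n : ℕ) : ∀ (a c : ℝ) (j : ℤ),
    itL n (fun x => c + ((x : ℝ) - a) ^ 2) j = c + ((j : ℝ) - a) ^ 2 + n := by
  induction n with
  | zero => intro a c j; simp [itL]
  | succ n ih => intro a c j; simp only [itL, ih]; push_cast; ring

lemma itL_right (n : ℕ) : ∀ (T : ℤ → ℝ) (j : ℤ),
    itL (n + 1) (fun x => ((n : ℝ) + 1 + ((x : ℝ) - j)) * T x) j = (n + 1) * itL n T (j + 1) := by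
  induction n with
  | zero => intro T j; simp only [itL]; push_cast; ring
  | succ n ih =>
    intro T j
    have h1 := ih T (j - 1)
    have h2 := ih T (j + 1)
    have e1 : (fun x : ℤ => (((n + 1 : ℕ) : ℝ) + 1 + ((x : ℝ) - j)) * T x)
        = fun x : ℤ => ((n : ℝ) + 1 + ((x : ℝ) - ((j - 1 : ℤ) : ℝ))) * T x := by
      funext x; push_cast; ring
    have e2 : (fun x : ℤ => (((n + 1 : ℕ) : ℝ) + 1 + ((x : ℝ) - j)) * T x)
        = fun x : ℤ => ((n : ℝ) + 1 + ((x : ℝ) - ((j + 1 : ℤ) : ℝ))) * T x + 2 * T x := by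
      funext x; push_cast; ring
    rw [itL]
    nth_rewrite 1 [e1]
    rw [e2, itL_add, itL_smul, h1, h2]
    simp only [itL]
    have a1 : j - 1 + 1 = j := by ring
    have a2 : j + 1 - 1 = j := by ring
    simp only [a1, a2]
    push_cast; ring

lemma itL_left (n : ℕ) : ∀ (T : ℤ → ℝ) (j : ℤ),
    itL (n + 1) (fun x => ((n : ℝ) + 1 - ((x : ℝ) - j)) * T x) j = (n + 1) * itL n T (j - 1) := by
  intro T j
  have h := itL_right n T j
  have h2 := itL_add (n + 1) (fun x => ((n : ℝ) + 1 - ((x : ℝ) - j)) * T x)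
    (fun x => ((n : ℝ) + 1 + ((x : ℝ) - j)) * T x) j
  have e : (fun x : ℤ => ((n : ℝ) + 1 - ((x : ℝ) - j)) * T x +
    ((n : ℝ) + 1 + ((x : ℝ) - j)) * T x) = fun x => (2 * ((n : ℝ) + 1)) * T x := by
    funext x; ring
  rw [e, itL_smul, h] at h2
  simp only [itL] at h2 ⊢
  linarith

lemma itL_key (n : ℕ) (T : ℤ → ℝ) (hT : ∀ x, |T x| ≤ 1) (j : ℤ) :
    |itL n T j - itL (n + 2) T j| ≤ 2 / (n + 1) := by
  have h1 := itL_right (n + 1) (fun x => ((n : ℝ) + 1 - ((x : ℝ) - ((j + 1 : ℤ) : ℝ))) * T x) j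
  rw [itL_left, show j + 1 - 1 = j by ring] at h1
  have e : (fun x : ℤ => (((n + 1 : ℕ) : ℝ) + 1 + ((x : ℝ) - j)) *
      (((n : ℝ) + 1 - ((x : ℝ) - ((j + 1 : ℤ) : ℝ))) * T x)) =
      fun x : ℤ => ((((n : ℝ) + 2) - ((x : ℝ) - j) ^ 2) * T x) +
        (((n : ℝ) + 2) * ((n : ℝ) + 1)) * T x := by
    funext x; push_cast; ring
  rw [e, itL_add, itL_smul] at h1
  have hb : ∀ x : ℤ, |(((n : ℝ) + 2) - ((x : ℝ) - j) ^ 2) * T x| ≤ (n + 2) + ((x : ℝ) - j) ^ 2 := by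
    intro x
    rw [abs_mul]
    have : |((n : ℝ) + 2) - ((x : ℝ) - j) ^ 2| ≤ (n + 2) + ((x : ℝ) - j) ^ 2 := by
      rw [abs_le]; constructor <;> nlinarith [sq_nonneg ((x : ℝ) - j), Nat.cast_nonneg (α := ℝ) n]
    calc _ ≤ ((n + 2) + ((x : ℝ) - j) ^ 2) * 1 :=
          mul_le_mul this (hT x) (abs_nonneg _) (by positivity)
      _ = _ := by ring
  have hs := itL_sq (n + 2) (j : ℝ) (n + 2) j
  have hu := itL_mono (n + 2) _ _ (fun x => (abs_le.1 (hb x)).2) j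
  have hl := itL_mono (n + 2) _ _ (fun x => (abs_le.1 (hb x)).1) j
  have hneg := itL_smul (n + 2) (-1) (fun x : ℤ => ((n : ℝ) + 2) + ((x : ℝ) - j) ^ 2) j
  simp only [neg_one_mul] at hneg
  rw [hs] at hu hneg
  rw [hneg] at hl
  push_cast at h1 hu hl
  simp only [add_assoc, Nat.reduceAdd] at h1 hu hl
  set A := itL n T j
  set B := itL (n + 2) T j
  set Q := itL (n + 2) (fun x : ℤ => (((n : ℝ) + 2) - ((x : ℝ) - j) ^ 2) * T x) j
  have hn : (0 : ℝ) ≤ n := Nat.cast_nonneg n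
  have hq : |Q| ≤ 2 * (n + 2) := by
    rw [abs_le]; constructor <;> nlinarith
  have hAB : ((n : ℝ) + 2) * ((n + 1) * (A - B)) = Q := by nlinarith
  rw [← hAB, abs_mul, abs_mul, abs_of_pos (by positivity : (0:ℝ) < n + 2),
    abs_of_pos (by positivity : (0:ℝ) < n + 1)] at hq
  rw [le_div_iff₀ (by positivity)]
  have : ((n : ℝ) + 1) * |A - B| ≤ 2 := by
    by_contra! hc
    nlinarith
  linarith

noncomputable def preS (f : ℤ → ℕ) (j : ℤ) : ℤ :=
  if Even ({i : ℤ | i < j ∧ Odd (f i)}.ncard) then 0 else 1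

lemma chi_eq (f : ℤ → ℕ) (hf : (Function.support f).Finite) (j : ℤ) :
    liarChi f j = preS f (j + 1) - preS f j := by
  have hfin : {i : ℤ | i < j ∧ Odd (f i)}.Finite := by
    refine hf.subset ?_
    rintro i ⟨_, hi⟩ h
    rw [h] at hi
    simp at hi
  unfold liarChi preS
  by_cases ho : Odd (f j)
  · have hs : {i : ℤ | i < j + 1 ∧ Odd (f i)} = insert j {i : ℤ | i < j ∧ Odd (f i)} := by
      ext i
      simp only [Set.mem_setOf_eq, Set.mem_insert_iff]
      constructor
      · rintro ⟨h1, h2⟩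
        by_cases hij : i = j
        · exact Or.inl hij
        · exact Or.inr ⟨by omega, h2⟩
      · rintro (h | ⟨h1, h2⟩)
        · subst h; exact ⟨by omega, ho⟩
        · exact ⟨by omega, h2⟩
    rw [hs, Set.ncard_insert_of_notMem (by simp) hfin, if_pos ho]
    by_cases he : Even ({i : ℤ | i < j ∧ Odd (f i)}.ncard)
    · rw [he.neg_one_pow, if_neg (by simp [Nat.even_add_one, he]), if_pos he]; norm_num
    · rw [(Nat.not_even_iff_odd.1 he).neg_one_pow, if_pos (by simp [Nat.even_add_one, he]), if_neg he]
      norm_num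
  · have hs : {i : ℤ | i < j + 1 ∧ Odd (f i)} = {i : ℤ | i < j ∧ Odd (f i)} := by
      ext i
      simp only [Set.mem_setOf_eq]
      constructor
      · rintro ⟨h1, h2⟩
        refine ⟨?_, h2⟩
        by_contra hc
        have : i = j := by omega
        subst this; exact ho h2
      · rintro ⟨h1, h2⟩
        exact ⟨by omega, h2⟩
    rw [hs, if_neg ho]; simp

lemma chi_zero (f : ℤ → ℕ) (j : ℤ) (h : f j = 0) : liarChi f j = 0 := by
  simp [liarChi, h]

lemma F_zero (F : ℕ → ℤ → ℕ) (hF : IsLiarEvolution F) (t : ℕ) (j : ℤ)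
    (h : F (t + 1) j ≠ 0) : F t (j - 1) ≠ 0 ∨ F t (j + 1) ≠ 0 := by
  by_contra! hc
  have := hF t j
  rw [chi_zero _ _ hc.1, chi_zero _ _ hc.2, hc.1, hc.2] at this
  omega

lemma F_fin (F : ℕ → ℤ → ℕ) (hF : IsLiarEvolution F)
    (hfin : (Function.support (F 0)).Finite) (t : ℕ) : (Function.support (F t)).Finite := by
  induction t with
  | zero => exact hfin
  | succ t ih =>
    refine ((ih.image (fun x => x + 1)).union (ih.image (fun x => x - 1))).subset ?_
    intro j hj
    rcases F_zero F hF t j hj with h | h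
    · exact Or.inl ⟨j - 1, h, by simp⟩
    · exact Or.inr ⟨j + 1, h, by simp⟩

lemma F_par (F : ℕ → ℤ → ℕ) (hF : IsLiarEvolution F) (p : ℤ)
    (hp : ∀ j : ℤ, F 0 j ≠ 0 → Even (j + p)) (t : ℕ) :
    ∀ j : ℤ, F t j ≠ 0 → Even (j + t + p) := by
  induction t with
  | zero => intro j hj; simpa using hp j hj
  | succ t ih =>
    intro j hj
    rcases F_zero F hF t j hj with h | h
    · have := ih _ h
      push_cast
      rw [Int.even_iff] at this ⊢
      omega
    · have := ih _ h
      push_cast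
      rw [Int.even_iff] at this ⊢
      omega

lemma err_eq (f : ℤ → ℕ) (hf : (Function.support f).Finite) (q : ℤ)
    (hq : ∀ j : ℤ, f j ≠ 0 → Even (j + q)) :
    ∃ T : ℤ → ℝ, (∀ x, |T x| ≤ 1) ∧ ∀ j : ℤ,
      ((liarChi f (j - 1) : ℝ) - liarChi f (j + 1)) / 2 = 2 * T j + (-2) * itL 2 T j := by
  refine ⟨fun j => if Even (j + q) then 0 else (preS f (j + 1) : ℝ), ?_, ?_⟩
  · intro x
    dsimp only
    unfold preS
    split_ifs <;> norm_num
  · intro j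
    have s1 : j - 1 - 1 = j - 2 := by ring
    have s2 : j - 1 + 1 = j := by ring
    have s3 : j + 1 - 1 = j := by ring
    have s4 : j + 1 + 1 = j + 2 := by ring
    have s5 : j - 2 + 1 = j - 1 := by ring
    have s6 : j + 2 + 1 = j + 3 := by ring
    simp only [itL, s1, s2, s3, s4, s5, s6]
    have p1 : Even (j - 2 + q) ↔ Even (j + q) := by
      rw [Int.even_iff, Int.even_iff]; omega
    have p2 : Even (j + 2 + q) ↔ Even (j + q) := by
      rw [Int.even_iff, Int.even_iff]; omega
    simp only [p1, p2]
    have hz : ∀ i, ¬ Even (i + q) → f i = 0 := fun i hi => by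
      by_contra hc; exact hi (hq i hc)
    by_cases he : Even (j + q)
    · rw [chi_zero f (j - 1), chi_zero f (j + 1)]
      · simp [he]
      · apply hz; rw [Int.even_iff] at he ⊢; omega
      · apply hz; rw [Int.even_iff] at he ⊢; omega
    · have c1 := chi_eq f hf (j - 1)
      have c2 := chi_eq f hf (j + 1)
      have c3 := chi_eq f hf j
      have c4 := chi_eq f hf (j + 2)
      rw [chi_zero f j (hz j he)] at c3
      rw [chi_zero f (j + 2) (hz _ (by rw [p2]; exact he))] at c4
      rw [s2] at c1
      rw [s4] at c2
      rw [s6] at c4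
      have d1 : liarChi f (j - 1) = preS f (j + 1) - preS f (j - 1) := by omega
      have d2 : liarChi f (j + 1) = preS f (j + 3) - preS f (j + 1) := by omega
      simp only [he, if_false, d1, d2]
      push_cast; ring

lemma main_bound (F : ℕ → ℤ → ℕ) (G : ℕ → ℤ → ℝ)
    (hfin : (Function.support (F 0)).Finite) (p : ℤ)
    (hp : ∀ j : ℤ, F 0 j ≠ 0 → Even (j + p))
    (hF : IsLiarEvolution F) (hG : IsLinearEvolution G)
    (h0 : ∀ j : ℤ, G 0 j = (F 0 j : ℝ)) (t : ℕ) : ∀ (n : ℕ) (j : ℤ),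
    |itL n (fun x => (F t x : ℝ) - G t x) j| ≤ ∑ k ∈ Finset.range t, (4 : ℝ) / (n + k + 1) := by
  induction t with
  | zero =>
    intro n j
    have : (fun x => (F 0 x : ℝ) - G 0 x) = fun x => 0 * (F 0 x : ℝ) := by
      funext x; rw [h0]; ring
    rw [this, itL_smul]; simp
  | succ t ih =>
    intro n j
    obtain ⟨T, hT, hE⟩ := err_eq (F t) (F_fin F hF hfin t) (t + p)
      (fun j hj => by rw [← add_assoc]; exact F_par F hF p hp t j hj)
    have e : (fun x => (F (t + 1) x : ℝ) - G (t + 1) x) = fun x =>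
        (((F t (x - 1) : ℝ) - G t (x - 1)) + ((F t (x + 1) : ℝ) - G t (x + 1))) / 2
        + (2 * T x + (-2) * itL 2 T x) := by
      funext x
      have h1 := hF t x
      have h1' : (F (t + 1) x : ℝ) * 2 = (F t (x - 1) : ℝ) + (F t (x + 1) : ℝ)
        + liarChi (F t) (x - 1) - liarChi (F t) (x + 1) := by exact_mod_cast h1
      rw [← hE x, hG t x]
      linarith
    have e2 : itL n (itL 2 T) j = itL (n + 2) T j := by
      rw [← itL_step (n + 1), ← itL_step n]
      rfl
    rw [e, itL_add, itL_step n (fun x => (F t x : ℝ) - G t x), itL_add, itL_smul, itL_smul, e2]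
    have b1 := ih (n + 1) j
    have b2 := itL_key n T hT j
    rw [Finset.sum_range_succ']
    have b3 : ∑ k ∈ Finset.range t, (4 : ℝ) / (((n + 1 : ℕ) : ℝ) + k + 1)
        = ∑ k ∈ Finset.range t, (4 : ℝ) / (n + ((k + 1 : ℕ) : ℝ) + 1) := by
      refine Finset.sum_congr rfl fun k _ => ?_
      push_cast; congr 1; ring
    rw [b3] at b1
    have b4 : (4 : ℝ) / (n + ((0 : ℕ) : ℝ) + 1) = 2 * (2 / (n + 1)) := by
      push_cast; rw [add_zero]; ring
    rw [b4]
    refine (abs_add_le _ _).trans (add_le_add b1 ?_)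
    rw [show 2 * itL n T j + -2 * itL (n + 2) T j = 2 * (itL n T j - itL (n + 2) T j) by ring,
      abs_mul, abs_two]
    linarith




theorem liar_machine_pointwise_discrepancy
    (F : ℕ → ℤ → ℕ) (G : ℕ → ℤ → ℝ)
    (hfin : (Function.support (F 0)).Finite)
    (hpar : (∀ j : ℤ, F 0 j ≠ 0 → Even j) ∨ (∀ j : ℤ, F 0 j ≠ 0 → Odd j))
    (hF : IsLiarEvolution F) (hG : IsLinearEvolution G)
    (h0 : ∀ j : ℤ, G 0 j = (F 0 j : ℝ))
    (t : ℕ) (ht : 2 ≤ t) (j : ℤ) :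
    |(F t j : ℝ) - G t j| < 12 * Real.log t := by
  obtain ⟨p, hp⟩ : ∃ p : ℤ, ∀ j : ℤ, F 0 j ≠ 0 → Even (j + p) := by
    rcases hpar with h | h
    · exact ⟨0, fun j hj => by simpa using h j hj⟩
    · exact ⟨1, fun j hj => (h j hj).add_one⟩
  have hb := main_bound F G hfin p hp hF hG h0 t 0 j
  have hh := harmonic_le_one_add_log t
  have hs : ∑ k ∈ Finset.range t, (4 : ℝ) / (((0 : ℕ) : ℝ) + k + 1) = 4 * (harmonic t : ℝ) := by
    rw [harmonic]
    push_cast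
    rw [Finset.mul_sum]
    refine Finset.sum_congr rfl fun k _ => ?_
    rw [zero_add]; rfl
  rw [hs] at hb
  have hl : Real.log 2 ≤ Real.log t := Real.log_le_log (by norm_num) (by exact_mod_cast ht)
  have h2 := Real.log_two_gt_d9
  simp only [itL] at hb
  linarith
end

section
/- There exists an absolute constant c′ > 0 such that the following holds. Let f_0 : ℤ → ℕ be finitely supported with support contained in the even integers or in the odd integers, let f_t evolve under the liar machine, and let g_t evolve under the linear machine with g_0 equal to f_0 (viewed as a function ℤ → ℝ). Then for all integers t ≥ 2 and all integers a < b, writing I = {a, a+1, …, b} and B = b − a: if B > √t/2 then |f_t(I) − g_t(I)| ≤ c′·√t, and if B ≤ √t/2 then |f_t(I) − g_t(I)| ≤ c′·B·log(t/B²), where log denotes the natural logarithm. -/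
namespace LM

noncomputable def P (u : ℤ → ℝ) (j : ℤ) : ℝ := (u (j - 1) + u (j + 1)) / 2

noncomputable def D (u : ℤ → ℝ) (j : ℤ) : ℝ := (u (j - 1) - u (j + 1)) / 2

lemma P_mono (n : ℕ) (u v : ℤ → ℝ) (h : ∀ j, u j ≤ v j) : ∀ j, P^[n] u j ≤ P^[n] v j := by
  induction n with
  | zero => simpa using h
  | succ n ih =>
    intro j
    rw [Function.iterate_succ_apply', Function.iterate_succ_apply']
    unfold P
    have h1 := ih (j - 1)
    have h2 := ih (j + 1)
    unfold P at h1 h2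
    linarith

lemma P_lin (n : ℕ) (u v : ℤ → ℝ) (c d : ℝ) : ∀ j,
    P^[n] (fun x => c * u x + d * v x) j = c * P^[n] u j + d * P^[n] v j := by
  induction n with
  | zero => simp
  | succ n ih =>
    intro j
    rw [Function.iterate_succ_apply', Function.iterate_succ_apply', Function.iterate_succ_apply']
    rw [P, ih, ih, P, P]
    ring

lemma P_sq (n : ℕ) (α β : ℝ) (j : ℤ) : ∀ y : ℤ,
    P^[n] (fun x => α + β * ((x : ℝ) - j) ^ 2) y = α + β * (((y : ℝ) - j) ^ 2 + n) := by
  induction n with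
  | zero => simp
  | succ n ih =>
    intro y
    rw [Function.iterate_succ_apply', P, ih, ih]
    push_cast
    ring

lemma P_D (n : ℕ) (u : ℤ → ℝ) : ∀ j, P^[n] (D u) j = D (P^[n] u) j := by
  induction n with
  | zero => simp
  | succ n ih =>
    intro j
    rw [Function.iterate_succ_apply', Function.iterate_succ_apply', P, ih, ih]
    simp only [D, P]
    ring_nf

lemma P_x (n : ℕ) (u : ℤ → ℝ) : ∀ y : ℤ,
    P^[n + 1] (fun x => (x : ℝ) * u x) y = y * P^[n + 1] u y - (n + 1) * D (P^[n] u) y := by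
  induction n with
  | zero => intro y; simp [P, D]; ring
  | succ n ih =>
    intro y
    rw [Function.iterate_succ_apply', P, ih, ih, Function.iterate_succ_apply' P (n + 1) u,
      Function.iterate_succ_apply' P n u]
    simp only [P, D]
    push_cast
    ring_nf

lemma D_bound (n : ℕ) (u : ℤ → ℝ) (K : ℝ) (hu : ∀ j, |u j| ≤ K) (y : ℤ) :
    |D (P^[n] u) y| ≤ K / √((n : ℝ) + 1) := by
  have hK : 0 ≤ K := (abs_nonneg _).trans (hu 0)
  have hN : (0 : ℝ) < (n : ℝ) + 1 := by positivity
  set r := √((n : ℝ) + 1) with hr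
  have hr0 : 0 < r := Real.sqrt_pos.mpr hN
  have hrr : r * r = (n : ℝ) + 1 := Real.mul_self_sqrt hN.le
  have key : ∀ x : ℤ, |((y : ℝ) - x) * u x| ≤ K * r / 2 + (K / (2 * r)) * ((x : ℝ) - y) ^ 2 := by
    intro x
    rw [abs_mul]
    have h1 : |(y : ℝ) - x| ≤ r / 2 + ((x : ℝ) - y) ^ 2 / (2 * r) := by
      have h2 : r / 2 + ((x : ℝ) - y) ^ 2 / (2 * r) - |(y : ℝ) - x|
          = (r - |(y : ℝ) - x|) ^ 2 / (2 * r) := by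
        have : ((x : ℝ) - y) ^ 2 = |(y : ℝ) - x| ^ 2 := by rw [sq_abs]; ring
        rw [this]
        field_simp
        ring
      have h3 : 0 ≤ (r - |(y : ℝ) - x|) ^ 2 / (2 * r) := by positivity
      linarith
    calc |(y : ℝ) - x| * |u x| ≤ (r / 2 + ((x : ℝ) - y) ^ 2 / (2 * r)) * K :=
          mul_le_mul h1 (hu x) (abs_nonneg _) (by positivity)
      _ = _ := by field_simp
  have e1 : P^[n + 1] (fun x : ℤ => ((y : ℝ) - x) * u x) y = (n + 1) * D (P^[n] u) y := by
    have : (fun x : ℤ => ((y : ℝ) - x) * u x)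
        = fun x : ℤ => (y : ℝ) * u x + (-1) * ((fun x : ℤ => (x : ℝ) * u x) x) := by
      funext x; ring
    rw [this, P_lin, P_x]
    ring
  have up := P_mono (n + 1) _ _ (fun x => (abs_le.mp (key x)).2) y
  have lo := P_mono (n + 1) (fun x : ℤ => (-(K * r / 2)) + (-(K / (2 * r))) * ((x : ℝ) - y) ^ 2)
    (fun x : ℤ => ((y : ℝ) - x) * u x) (fun x => by have := (abs_le.mp (key x)).1; linarith) y
  rw [e1, P_sq] at up
  rw [e1, P_sq] at lo
  push_cast at up lo
  have e2 : K * r / 2 + K / (2 * r) * (((y : ℝ) - y) ^ 2 + ((n : ℝ) + 1)) = K / r * (n + 1) := by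
    rw [← hrr]; field_simp; ring
  rw [abs_le]
  constructor
  · have : -(K / r) * (n + 1) ≤ D (P^[n] u) y * (n + 1) := by linarith
    exact le_of_mul_le_mul_right this hN
  · have : D (P^[n] u) y * (n + 1) ≤ (K / r) * (n + 1) := by linarith
    exact le_of_mul_le_mul_right this hN

lemma DD_bound (n : ℕ) (u : ℤ → ℝ) (hu : ∀ j, |u j| ≤ 1) (y : ℤ) :
    |D (D (P^[n] u)) y| ≤ 2 / ((n : ℝ) + 1) := by
  obtain ⟨m, k, hmk, hk, hk'⟩ : ∃ m k : ℕ, n = m + k ∧ m ≤ k ∧ k ≤ m + 1 :=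
    ⟨n / 2, n - n / 2, by omega, by omega, by omega⟩
  have h1 := D_bound k u 1 hu
  have h2 := D_bound m (D (P^[k] u)) _ h1 y
  have e : P^[m] (D (P^[k] u)) = D (P^[n] u) := by
    funext j
    rw [P_D, hmk, Function.iterate_add_apply]
  rw [e] at h2
  refine h2.trans ?_
  rw [div_div, ← Real.sqrt_mul (by positivity)]
  have hn : (n : ℝ) = m + k := by rw [hmk]; push_cast; rfl
  have h3 : ((n : ℝ) + 1) / 2 ≤ √(((k : ℝ) + 1) * ((m : ℝ) + 1)) := by
    apply Real.le_sqrt_of_sq_le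
    have a1 : (m : ℝ) ≤ k := by exact_mod_cast hk
    have a2 : (k : ℝ) ≤ m + 1 := by exact_mod_cast hk'
    have a3 : (0 : ℝ) ≤ m := by positivity
    rw [hn]
    nlinarith
  calc 1 / √(((k : ℝ) + 1) * ((m : ℝ) + 1)) ≤ 1 / (((n : ℝ) + 1) / 2) :=
        one_div_le_one_div_of_le (by positivity) h3
    _ = _ := by field_simp

lemma sum_D (v : ℤ → ℝ) (a : ℤ) (m : ℕ) :
    ∑ i ∈ Finset.Icc a (a + m), D v i = (v (a - 1) + v a - v (a + m) - v (a + m + 1)) / 2 := by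
  induction m with
  | zero => simp [D]
  | succ m ih =>
    have : Finset.Icc a (a + (m + 1 : ℕ)) = insert (a + m + 1) (Finset.Icc a (a + m)) := by
      ext x; simp only [Finset.mem_Icc, Finset.mem_insert]; push_cast; omega
    rw [this, Finset.sum_insert (by simp only [Finset.mem_Icc]; omega), ih]
    simp only [D]
    push_cast
    ring_nf

lemma int_bound1 (n : ℕ) (u : ℤ → ℝ) (hu : ∀ j, |u j| ≤ 1) (a : ℤ) (m : ℕ) :
    |∑ i ∈ Finset.Icc a (a + m), D (D (P^[n] u)) i| ≤ 2 / √((n : ℝ) + 1) := by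
  rw [sum_D]
  have h := fun y => abs_le.mp (D_bound n u 1 hu y)
  have e : 2 / √((n : ℝ) + 1) = 2 * (1 / √((n : ℝ) + 1)) := by ring
  rw [e, abs_le]
  have h1 := h (a - 1)
  have h2 := h a
  have h3 := h (a + m)
  have h4 := h (a + m + 1)
  constructor <;> linarith [h1.1, h1.2, h2.1, h2.2, h3.1, h3.2, h4.1, h4.2]

lemma int_bound2 (n : ℕ) (u : ℤ → ℝ) (hu : ∀ j, |u j| ≤ 1) (a : ℤ) (m : ℕ) (hm : 1 ≤ m) :
    |∑ i ∈ Finset.Icc a (a + m), D (D (P^[n] u)) i| ≤ 4 * m / ((n : ℝ) + 1) := by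
  refine (Finset.abs_sum_le_sum_abs _ _).trans ?_
  refine (Finset.sum_le_card_nsmul _ _ _ (fun i _ => DD_bound n u hu i)).trans ?_
  rw [Int.card_Icc, nsmul_eq_mul]
  have : (a + m + 1 - a).toNat = m + 1 := by omega
  rw [this]
  have h1 : (1 : ℝ) ≤ m := by exact_mod_cast hm
  rw [← mul_div_assoc]
  apply div_le_div_of_nonneg_right _ (by positivity)
  push_cast
  linarith

lemma sum1 (x : ℕ → ℝ) (hx : ∀ n, x n ≤ 4 / √((n : ℝ) + 1)) (t : ℕ) :
    ∑ n ∈ Finset.range t, x n ≤ 8 * √t := by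
  induction t with
  | zero => simp
  | succ t ih =>
    rw [Finset.sum_range_succ]
    have h1 := hx t
    push_cast
    set r := √((t : ℝ) + 1) with hr
    have hr0 : 0 < r := Real.sqrt_pos.mpr (by positivity)
    have hrr : r * r = (t : ℝ) + 1 := Real.mul_self_sqrt (by positivity)
    have hq : √(t : ℝ) * √(t : ℝ) = t := Real.mul_self_sqrt (by positivity)
    have h2 : 4 / r ≤ 8 * r - 8 * √(t : ℝ) := by
      rw [div_le_iff₀ hr0]
      nlinarith [sq_nonneg (r - √(t : ℝ))]
    linarith

lemma sum2 (x : ℕ → ℝ) (m : ℕ) (hm : 1 ≤ m) (hx : ∀ n, x n ≤ 4 / √((n : ℝ) + 1))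
    (hx2 : ∀ n, x n ≤ 8 * m / ((n : ℝ) + 1)) (t : ℕ) (ht : m ^ 2 ≤ t) :
    ∑ n ∈ Finset.range t, x n ≤ 8 * m + 8 * m * Real.log ((t : ℝ) / (m : ℝ) ^ 2) := by
  have hm0 : (0 : ℝ) < m := by exact_mod_cast hm
  induction t, ht using Nat.le_induction with
  | base =>
    have := sum1 x hx (m ^ 2)
    push_cast at this ⊢
    rw [Real.sqrt_sq hm0.le] at this
    rw [div_self (by positivity)]
    simpa using this
  | succ t ht ih =>
    rw [Finset.sum_range_succ]
    have h1 := hx2 t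
    have ht1 : 1 ≤ t := le_trans (Nat.one_le_pow _ _ hm) ht
    have ht0 : (0 : ℝ) < t := by exact_mod_cast ht1
    have h2 := Real.one_sub_inv_le_log_of_pos (x := ((t : ℝ) + 1) / t) (by positivity)
    have e : 1 - (((t : ℝ) + 1) / t)⁻¹ = 1 / ((t : ℝ) + 1) := by field_simp; ring
    rw [e] at h2
    rw [Real.log_div (by positivity) (by positivity)] at h2 ih ⊢
    push_cast
    have h3 : 8 * m / ((t : ℝ) + 1) = 8 * m * (1 / ((t : ℝ) + 1)) := by ring
    have h4 := mul_le_mul_of_nonneg_left h2 (by positivity : (0 : ℝ) ≤ 8 * m)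
    rw [h3] at h1
    linarith

lemma chi_zero (f : ℤ → ℕ) (j : ℤ) (h : f j = 0) : liarChi f j = 0 := by
  simp [liarChi, h]

lemma theta_exists (f : ℤ → ℕ) (hf : (Function.support f).Finite) (p : ℤ)
    (hp : ∀ j, f j ≠ 0 → Even (j - p)) :
    ∃ θ : ℤ → ℝ, (∀ j, |θ j| ≤ 1) ∧ ∀ j, (liarChi f j : ℝ) = -2 * D θ j := by
  classical
  refine ⟨fun j => if Even (j - p) then 0 else
    (if Odd ({i : ℤ | i < j ∧ Odd (f i)}.ncard) then 1 else 0), ?_, ?_⟩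
  · intro j
    dsimp only
    split_ifs <;> simp
  · intro j
    simp only [D]
    have hsub : ∀ i, Odd (f i) → f i ≠ 0 := by
      intro i h h0; rw [h0] at h; simp at h
    by_cases hj : Even (j - p)
    · have h1 : ¬ Even (j - 1 - p) := by grind
      have h2 : ¬ Even (j + 1 - p) := by grind
      have h3 : ¬ Odd (f (j - 1)) := fun h => h1 (hp _ (hsub _ h))
      rw [if_neg h1, if_neg h2]
      have e1 : {i : ℤ | i < j - 1 ∧ Odd (f i)} = {i : ℤ | i < j ∧ Odd (f i)} := by
        ext i
        simp only [Set.mem_ofPred_eq]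
        constructor
        · rintro ⟨h, h'⟩; exact ⟨by omega, h'⟩
        · rintro ⟨h, h'⟩
          refine ⟨?_, h'⟩
          have : i ≠ j - 1 := by rintro rfl; exact h3 h'
          omega
      rw [e1]
      have hfin : {i : ℤ | i < j ∧ Odd (f i)}.Finite :=
        hf.subset (fun i hi => hsub i hi.2)
      by_cases ho : Odd (f j)
      · have e2 : {i : ℤ | i < j + 1 ∧ Odd (f i)} = insert j {i : ℤ | i < j ∧ Odd (f i)} := by
          ext i
          simp only [Set.mem_ofPred_eq, Set.mem_insert_iff]
          constructor
          · rintro ⟨h, h'⟩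
            rcases eq_or_ne i j with h'' | h''
            · exact Or.inl h''
            · exact Or.inr ⟨by omega, h'⟩
          · rintro (rfl | ⟨h, h'⟩)
            · exact ⟨by omega, ho⟩
            · exact ⟨by omega, h'⟩
        rw [e2, Set.ncard_insert_of_notMem (by simp) hfin, liarChi, if_pos ho]
        by_cases hN : Odd ({i : ℤ | i < j ∧ Odd (f i)}.ncard)
        · have hN' : ¬ Odd ({i : ℤ | i < j ∧ Odd (f i)}.ncard + 1) := by grind
          rw [if_pos hN, if_neg hN', hN.neg_one_pow]; norm_num
        · have hN' : Odd ({i : ℤ | i < j ∧ Odd (f i)}.ncard + 1) := by grind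
          rw [if_neg hN, if_pos hN', (Nat.not_odd_iff_even.mp hN).neg_one_pow]; norm_num
      · have e2 : {i : ℤ | i < j + 1 ∧ Odd (f i)} = {i : ℤ | i < j ∧ Odd (f i)} := by
          ext i
          simp only [Set.mem_ofPred_eq]
          constructor
          · rintro ⟨h, h'⟩
            refine ⟨?_, h'⟩
            have : i ≠ j := by rintro rfl; exact ho h'
            omega
          · rintro ⟨h, h'⟩; exact ⟨by omega, h'⟩
        rw [e2, liarChi, if_neg ho]
        simp
    · have h1 : Even (j - 1 - p) := by grind
      have h2 : Even (j + 1 - p) := by grind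
      have h0 : f j = 0 := by
        by_contra h; exact hj (hp _ h)
      rw [if_pos h1, if_pos h2, chi_zero f j h0]
      simp

lemma supp_step (F : ℕ → ℤ → ℕ) (hF : IsLiarEvolution F)
    (h0 : (Function.support (F 0)).Finite) (p0 : ℤ) (hp0 : ∀ j, F 0 j ≠ 0 → Even (j - p0)) (t : ℕ) :
    (Function.support (F t)).Finite ∧ ∃ p : ℤ, ∀ j, F t j ≠ 0 → Even (j - p) := by
  induction t with
  | zero => exact ⟨h0, p0, hp0⟩
  | succ t ih =>
    obtain ⟨hfin, p, hp⟩ := ih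
    have key : ∀ j, F (t + 1) j ≠ 0 → F t (j - 1) ≠ 0 ∨ F t (j + 1) ≠ 0 := by
      intro j hj
      by_contra hcon
      push Not at hcon
      have := hF t j
      rw [chi_zero _ _ hcon.1, chi_zero _ _ hcon.2, hcon.1, hcon.2] at this
      omega
    refine ⟨?_, p + 1, ?_⟩
    · refine ((hfin.image (fun x => x + 1)).union (hfin.image (fun x => x - 1))).subset ?_
      intro j hj
      rcases key j hj with h | h
      · exact Or.inl ⟨j - 1, h, by ring⟩
      · exact Or.inr ⟨j + 1, h, by ring⟩
    · intro j hj
      rcases key j hj with h | h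
      · have := hp _ h; grind
      · have := hp _ h; grind

lemma P_sum (s : Finset ℕ) (w : ℕ → ℤ → ℝ) (j : ℤ) :
    P (fun y => ∑ i ∈ s, w i y) j = ∑ i ∈ s, P (w i) j := by
  simp only [P]
  rw [← Finset.sum_add_distrib, Finset.sum_div]

lemma duhamel (E : ℕ → ℤ → ℝ) (θ : ℕ → ℤ → ℝ) (h0 : ∀ j, E 0 j = 0)
    (h : ∀ t j, E (t + 1) j = P (E t) j + D (fun y => -2 * D (θ t) y) j) (t : ℕ) :
    ∀ j, E t j = ∑ s ∈ Finset.range t, -2 * D (D (P^[t - 1 - s] (θ s))) j := by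
  induction t with
  | zero => simpa using h0
  | succ t ih =>
    intro j
    rw [h, funext ih, P_sum, Finset.sum_range_succ]
    congr 1
    · apply Finset.sum_congr rfl
      intro s hs
      rw [Finset.mem_range] at hs
      have : t + 1 - 1 - s = (t - 1 - s) + 1 := by omega
      rw [this, Function.iterate_succ_apply']
      simp only [P, D]
      ring_nf
    · have : t + 1 - 1 - t = 0 := by omega
      rw [this]
      simp only [D, Function.iterate_zero, id]
      ring

end LM

open LM in
theorem liar_machine_interval_discrepancy :
    ∃ c' : ℝ, 0 < c' ∧
      ∀ (F : ℕ → ℤ → ℕ) (G : ℕ → ℤ → ℝ),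
        (Function.support (F 0)).Finite →
        ((∀ j : ℤ, F 0 j ≠ 0 → Even j) ∨ (∀ j : ℤ, F 0 j ≠ 0 → Odd j)) →
        IsLiarEvolution F → IsLinearEvolution G →
        (∀ j : ℤ, G 0 j = (F 0 j : ℝ)) →
        ∀ (t : ℕ), 2 ≤ t → ∀ (a b : ℤ), a < b →
          (((b - a : ℤ) : ℝ) > Real.sqrt t / 2 →
            |(∑ i ∈ Finset.Icc a b, (F t i : ℝ)) - ∑ i ∈ Finset.Icc a b, G t i| ≤
              c' * Real.sqrt t) ∧
          (((b - a : ℤ) : ℝ) ≤ Real.sqrt t / 2 →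
            |(∑ i ∈ Finset.Icc a b, (F t i : ℝ)) - ∑ i ∈ Finset.Icc a b, G t i| ≤
              c' * ((b - a : ℤ) : ℝ) * Real.log ((t : ℝ) / ((b - a : ℤ) : ℝ) ^ 2)) := by
  refine ⟨16, by norm_num, ?_⟩
  intro F G hfin hpar hF hG h0 t ht a b hab
  obtain ⟨p, hp⟩ : ∃ p : ℤ, ∀ j, F 0 j ≠ 0 → Even (j - p) := by
    rcases hpar with h | h
    · exact ⟨0, fun j hj => by simpa using h j hj⟩
    · exact ⟨1, fun j hj => by have := h j hj; grind⟩
  have hθ : ∀ s, ∃ θ : ℤ → ℝ, (∀ j, |θ j| ≤ 1) ∧ ∀ j, (liarChi (F s) j : ℝ) = -2 * D θ j := by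
    intro s
    obtain ⟨h1, q, h2⟩ := supp_step F hF hfin p hp s
    exact theta_exists _ h1 q h2
  choose θ hθ1 hθ2 using hθ
  have hE := duhamel (fun t j => (F t j : ℝ) - G t j) θ (fun j => by simp [h0]) (by
    intro s j
    have h1 : ((F (s + 1) j : ℝ)) * 2 = (F s (j - 1) : ℝ) + (F s (j + 1) : ℝ)
        + (liarChi (F s) (j - 1) : ℝ) - (liarChi (F s) (j + 1) : ℝ) := by
      exact_mod_cast hF s j
    have h2 := hG s j
    rw [← funext (hθ2 s)]
    simp only [P, D]
    linarith) t
  obtain ⟨m, rfl⟩ : ∃ m : ℕ, b = a + m := ⟨(b - a).toNat, by omega⟩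
  have hm : 1 ≤ m := by omega
  have hB : ((a + m - a : ℤ) : ℝ) = m := by push_cast; ring
  rw [hB]
  set S : ℕ → ℝ := fun n => 2 * |∑ i ∈ Finset.Icc a (a + m), D (D (P^[n] (θ (t - 1 - n)))) i| with hS
  have hmain : |(∑ i ∈ Finset.Icc a (a + m), (F t i : ℝ)) - ∑ i ∈ Finset.Icc a (a + m), G t i|
      ≤ ∑ n ∈ Finset.range t, S n := by
    rw [← Finset.sum_sub_distrib, Finset.sum_congr rfl (fun i _ => hE i), Finset.sum_comm,
      ← Finset.sum_range_reflect S]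
    refine (Finset.abs_sum_le_sum_abs _ _).trans (Finset.sum_le_sum ?_)
    intro s hs
    rw [Finset.mem_range] at hs
    have : t - 1 - (t - 1 - s) = s := by omega
    rw [← Finset.mul_sum, abs_mul, hS]
    simp only [this]
    norm_num
  have b1 : ∀ n, S n ≤ 4 / √((n : ℝ) + 1) := by
    intro n
    have := int_bound1 n _ (hθ1 (t - 1 - n)) a m
    have e : 4 / √((n : ℝ) + 1) = 2 * (2 / √((n : ℝ) + 1)) := by ring
    rw [e]
    simp only [hS]
    linarith
  have b2 : ∀ n, S n ≤ 8 * m / ((n : ℝ) + 1) := by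
    intro n
    have := int_bound2 n _ (hθ1 (t - 1 - n)) a m hm
    have e : 8 * m / ((n : ℝ) + 1) = 2 * (4 * m / ((n : ℝ) + 1)) := by ring
    rw [e]
    simp only [hS]
    linarith
  constructor
  · intro _
    have := sum1 S b1 t
    have h3 := Real.sqrt_nonneg (t : ℝ)
    linarith
  · intro hle
    have hm0 : (0 : ℝ) < m := by exact_mod_cast hm
    have h4 : 4 * (m : ℝ) ^ 2 ≤ t := by
      have hq : √(t : ℝ) * √(t : ℝ) = t := Real.mul_self_sqrt (by positivity)
      nlinarith
    have hmt : m ^ 2 ≤ t := by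
      have : (m : ℝ) ^ 2 ≤ t := by nlinarith
      exact_mod_cast this
    have h5 := sum2 S m hm b1 b2 t hmt
    have h6 : 1 ≤ Real.log ((t : ℝ) / (m : ℝ) ^ 2) := by
      rw [Real.le_log_iff_exp_le (by positivity), le_div_iff₀ (by positivity)]
      have := Real.exp_one_lt_d9
      nlinarith [sq_nonneg (m : ℝ)]
    have h7 := mul_le_mul_of_nonneg_left h6 (by positivity : (0 : ℝ) ≤ 8 * m)
    linarith
end

section
/- For every integer s ≥ 1, every even integer B ≥ 2, and every j ∈ ℤ, |h_B(j)| ≤ 3B/(2s). -/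
/-- `chooseHalf s m = C(s, m/2)`, with the convention that it is `0` unless
`m/2` is an integer with `0 ≤ m/2` (and `Nat.choose` gives `0` when `m/2 > s`). -/
noncomputable def chooseHalf (s : ℕ) (m : ℤ) : ℝ :=
  if 2 ∣ m ∧ 0 ≤ m then (s.choose (m / 2).toNat : ℝ) else 0

/-- `hB s B j = 2^{-s} (C(s, (s+j-B)/2) - C(s, (s+j)/2))`. -/
noncomputable def hB (s : ℕ) (B : ℤ) (j : ℤ) : ℝ :=
  ((2 : ℝ) ^ s)⁻¹ * (chooseHalf s ((s : ℤ) + j - B) - chooseHalf s ((s : ℤ) + j))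

theorem aux_mono (n m i : ℕ) (h : m ≤ i) (hi : 2 * i ≤ n) : n.choose m ≤ n.choose i := by
  induction i, h using Nat.le_induction with
  | base => exact le_rfl
  | succ i h ih =>
    exact (ih (by omega)).trans (Nat.choose_le_succ_of_lt_half_left (by omega))

theorem aux_mono2 (n m i : ℕ) (h : m ≤ i) (hi : i + m ≤ n) : n.choose m ≤ n.choose i := by
  by_cases h2 : 2 * i ≤ n
  · exact aux_mono n m i h h2
  · rw [← Nat.choose_symm (show i ≤ n by omega)]
    exact aux_mono n m _ (by omega) (by omega)

theorem aux_sum (n m : ℕ) (h : 2 * m ≤ n) : (n - 2 * m + 1) * n.choose m ≤ 2 ^ n := by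
  rw [← Nat.sum_range_choose]
  calc (n - 2 * m + 1) * n.choose m = ∑ i ∈ Finset.Icc m (n - m), n.choose m := by
        rw [Finset.sum_const, Nat.card_Icc, smul_eq_mul]
        congr 1
        omega
    _ ≤ ∑ i ∈ Finset.Icc m (n - m), n.choose i := by
        apply Finset.sum_le_sum
        intro i hi
        rw [Finset.mem_Icc] at hi
        exact aux_mono2 n m i hi.1 (by omega)
    _ ≤ _ := by
        apply Finset.sum_le_sum_of_subset
        intro i hi
        rw [Finset.mem_Icc] at hi
        rw [Finset.mem_range]
        omega

theorem aux_abs1 (n m : ℕ) (h : 2 * m ≤ n) :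
    |(n : ℝ) - 2 * m| * n.choose m ≤ 2 ^ n := by
  have h1 := aux_sum n m h
  have h2 : (((n - 2 * m + 1) * n.choose m : ℕ) : ℝ) ≤ ((2 ^ n : ℕ) : ℝ) := by exact_mod_cast h1
  push_cast [Nat.cast_sub h] at h2
  have h3 : (0 : ℝ) ≤ n - 2 * m := by
    have : ((2 * m : ℕ) : ℝ) ≤ n := by exact_mod_cast h
    push_cast at this
    linarith
  rw [abs_of_nonneg h3]
  have : (0 : ℝ) ≤ n.choose m := by positivity
  linarith

theorem aux_abs (n m : ℕ) : |(n : ℝ) - 2 * m| * n.choose m ≤ 2 ^ n := by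
  by_cases h : 2 * m ≤ n
  · exact aux_abs1 n m h
  by_cases h2 : m ≤ n
  · have := aux_abs1 n (n - m) (by omega)
    rw [Nat.choose_symm h2, Nat.cast_sub h2, abs_sub_comm] at this
    convert this using 3
    ring
  · rw [Nat.choose_eq_zero_of_lt (by omega)]
    simp

theorem aux_step (s k : ℕ) :
    (s : ℝ) * |(s.choose (k + 1) : ℝ) - s.choose k| ≤ 3 * 2 ^ s := by
  have h := aux_abs (s + 1) (k + 1)
  have h1 : ((s : ℝ) + 1) * s.choose k = (s + 1).choose (k + 1) * (k + 1) := by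
    exact_mod_cast Nat.add_one_mul_choose_eq s k
  have h2 : ((s + 1).choose (k + 1) : ℝ) = s.choose k + s.choose (k + 1) := by
    exact_mod_cast Nat.choose_succ_succ s k
  have h3 : ((s : ℝ) + 1) * ((s.choose (k + 1) : ℝ) - s.choose k)
      = (((s + 1 : ℕ) : ℝ) - 2 * (k + 1 : ℕ)) * (s + 1).choose (k + 1) := by
    push_cast
    have : (s.choose (k + 1) : ℝ) = (s + 1).choose (k + 1) - s.choose k := by linarith
    rw [this]
    linear_combination (-2) * h1
  have h4 := congrArg abs h3
  rw [abs_mul, abs_mul, abs_of_nonneg (by positivity : (0 : ℝ) ≤ (s : ℝ) + 1),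
    abs_of_nonneg (by positivity : (0 : ℝ) ≤ ((s + 1).choose (k + 1) : ℝ))] at h4
  rw [← h4, pow_succ] at h
  have := abs_nonneg ((s.choose (k + 1) : ℝ) - s.choose k)
  have : (0 : ℝ) < 2 ^ s := by positivity
  nlinarith

theorem aux_stepZ (s : ℕ) (k : ℤ) :
    (s : ℝ) * |chooseHalf s (2 * (k + 1)) - chooseHalf s (2 * k)| ≤ 3 * 2 ^ s := by
  have e : ∀ n : ℕ, chooseHalf s (2 * (n : ℤ)) = s.choose n := by
    intro n
    simp [chooseHalf]
  have z : ∀ n : ℤ, n < 0 → chooseHalf s (2 * n) = 0 := by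
    intro n hn
    rw [chooseHalf, if_neg]
    omega
  have hp : (0 : ℝ) < 2 ^ s := by positivity
  rcases lt_trichotomy k (-1) with h | h | h
  · rw [z _ (by omega), z _ (by omega)]
    simp
  · subst h
    rw [z (-1) (by omega)]
    have := e 0
    norm_num at this ⊢
    rw [this]
    have h2 : (s : ℝ) ≤ 2 ^ s := by exact_mod_cast (Nat.lt_two_pow_self (n := s)).le
    norm_num
    linarith
  · obtain ⟨n, rfl⟩ := Int.eq_ofNat_of_zero_le (show 0 ≤ k by omega)
    have := e (n + 1)
    push_cast at this
    rw [this, e]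
    exact aux_step s n

theorem aux_many (s : ℕ) (k : ℤ) (b : ℕ) :
    (s : ℝ) * |chooseHalf s (2 * (k + b)) - chooseHalf s (2 * k)| ≤ b * (3 * 2 ^ s) := by
  induction b with
  | zero => simp
  | succ b ih =>
    have h := aux_stepZ s (k + b)
    have t := abs_sub_le (chooseHalf s (2 * (k + b + 1))) (chooseHalf s (2 * (k + b)))
      (chooseHalf s (2 * k))
    have t2 := mul_le_mul_of_nonneg_left t (Nat.cast_nonneg (α := ℝ) s)
    push_cast
    rw [← add_assoc]
    linarith

theorem hB_upper_bound_small (s : ℕ) (hs : 1 ≤ s) (B : ℤ) (hBeven : Even B)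
    (hB2 : 2 ≤ B) (j : ℤ) :
    |hB s B j| ≤ 3 * (B : ℝ) / (2 * s) := by
  have hs0 : (0 : ℝ) < s := by exact_mod_cast hs
  have hp : (0 : ℝ) < 2 ^ s := by positivity
  obtain ⟨c, rfl⟩ := hBeven
  obtain ⟨b, rfl⟩ := Int.eq_ofNat_of_zero_le (show 0 ≤ c by omega)
  by_cases hpar : (2 : ℤ) ∣ (s : ℤ) + j
  · obtain ⟨m, hm⟩ := hpar
    have h := aux_many s (m - b) b
    rw [hB, hm, abs_mul, abs_of_nonneg (by positivity), abs_sub_comm]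
    rw [show 2 * m - ((b : ℤ) + b) = 2 * (m - b) by ring]
    rw [sub_add_cancel] at h
    rw [inv_mul_eq_div, div_le_div_iff₀ hp (by positivity)]
    push_cast
    linarith
  · rw [hB, chooseHalf, chooseHalf, if_neg (by omega), if_neg (by omega)]
    simp
    positivity
end

section
/- There exist a constant c > 0 and an integer S such that for every integer s ≥ S and every even integer B ≥ 2: max_{j ∈ ℤ} |h_B(j)| ≥ c·min(B, √s)/s. In particular, when B ≥ √s the maximum of |h_B| is at least c/√s, and when B ≤ √s it is at least c·B/s. -/
theorem hBaux_central (n : ℕ) (hn : 1 ≤ n) : 16 ^ n ≤ (Nat.centralBinom n) ^ 2 * (4 * n) := by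
  induction n, hn using Nat.le_induction with
  | base => simp [Nat.centralBinom, Nat.choose]
  | succ n hn ih =>
    have h := Nat.succ_mul_centralBinom_succ n
    have h2 : (n + 1) * 16 ^ (n + 1) ≤
        (n + 1) * ((Nat.centralBinom (n + 1)) ^ 2 * (4 * (n + 1))) := by
      calc (n + 1) * 16 ^ (n + 1) = 16 * (n + 1) * 16 ^ n := by ring
        _ ≤ 16 * (n + 1) * ((Nat.centralBinom n) ^ 2 * (4 * n)) := Nat.mul_le_mul_left _ ih
        _ = 16 * (4 * n ^ 2 + 4 * n) * (Nat.centralBinom n) ^ 2 := by ring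
        _ ≤ 16 * (2 * n + 1) ^ 2 * (Nat.centralBinom n) ^ 2 := by
          apply Nat.mul_le_mul_right
          nlinarith
        _ = 4 * (2 * (2 * n + 1) * Nat.centralBinom n) ^ 2 := by ring
        _ = 4 * ((n + 1) * Nat.centralBinom (n + 1)) ^ 2 := by rw [h]
        _ = _ := by ring
    exact Nat.le_of_mul_le_mul_left h2 (by omega)

theorem hBaux_mid (s : ℕ) (hs : 1 ≤ s) : 4 ^ s ≤ (s.choose (s / 2)) ^ 2 * (2 * (s + 1)) := by
  rcases Nat.even_or_odd' s with ⟨n, rfl | rfl⟩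
  · have h := hBaux_central n (by omega)
    have e : 2 * n / 2 = n := by omega
    rw [e, ← Nat.centralBinom_eq_two_mul_choose, pow_mul]
    norm_num
    refine h.trans (Nat.mul_le_mul_left _ (by omega))
  · have h := hBaux_central (n + 1) (by omega)
    have e : (2 * n + 1) / 2 = n := by omega
    have h3 : Nat.centralBinom (n + 1) = 2 * (2 * n + 1).choose n := by
      rw [Nat.centralBinom_eq_two_mul_choose, show 2 * (n + 1) = 2 * n + 1 + 1 by ring,
        Nat.choose_succ_succ, Nat.choose_symm_half]
      ring
    rw [e]
    rw [h3] at h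
    have e2 : (4 : ℕ) ^ (2 * n + 1) * 4 = 16 ^ (n + 1) := by
      rw [← pow_succ, show 2 * n + 1 + 1 = 2 * (n + 1) by ring, pow_mul]
      norm_num
    nlinarith

theorem hBaux_step (s i : ℕ) (h : s / 2 + i ≤ s) :
    ((s / 2 + i : ℕ) + 1 : ℝ) * ((s.choose (s / 2 + i) : ℝ) - s.choose (s / 2 + (i + 1))) =
      (s.choose (s / 2 + i) : ℝ) * (2 * (s / 2 + i : ℕ) + 1 - s) := by
  have h1 := Nat.choose_succ_right_eq s (s / 2 + i)
  have h2 : ((s.choose (s / 2 + i + 1) : ℝ)) * ((s / 2 + i : ℕ) + 1) =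
      s.choose (s / 2 + i) * ((s : ℝ) - (s / 2 + i : ℕ)) := by
    rw [← Nat.cast_sub h]
    exact_mod_cast h1
  rw [← add_assoc]
  linarith

theorem hBaux_anti (s : ℕ) : Antitone (fun i : ℕ => (s.choose (s / 2 + i) : ℝ)) := by
  apply antitone_nat_of_succ_le
  intro i
  have h1 := Nat.choose_succ_right_eq s (s / 2 + i)
  have h2 : s.choose (s / 2 + i + 1) ≤ s.choose (s / 2 + i) := by
    have h3 : s - (s / 2 + i) ≤ s / 2 + i + 1 := by omega
    have h4 : s.choose (s / 2 + i + 1) * (s / 2 + i + 1) ≤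
        s.choose (s / 2 + i) * (s / 2 + i + 1) := by
      rw [h1]
      exact Nat.mul_le_mul_left _ h3
    exact Nat.le_of_mul_le_mul_right h4 (by omega)
  exact_mod_cast h2

theorem hBaux_lower (s r : ℕ) (hr : 1 ≤ r) (hrs : 40 * r ^ 2 ≤ s) (i : ℕ) (hi : i ≤ 2 * r) :
    (s.choose (s / 2) : ℝ) * (1 - i * (10 * r / s)) ≤ s.choose (s / 2 + i) := by
  have hspos : (0 : ℝ) < s := by
    have : 0 < s := by nlinarith
    exact_mod_cast this
  have hr2 : r ≤ r ^ 2 := by nlinarith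
  induction i with
  | zero => simp
  | succ i ih =>
    have ih := ih (by omega)
    have hst := hBaux_step s i (by omega)
    have ha : (s.choose (s / 2 + i) : ℝ) ≤ s.choose (s / 2) := hBaux_anti s (Nat.zero_le i)
    set C0 : ℝ := (s.choose (s / 2) : ℝ)
    set C1 : ℝ := (s.choose (s / 2 + i) : ℝ)
    set C2 : ℝ := (s.choose (s / 2 + (i + 1)) : ℝ)
    have hC1 : 0 ≤ C1 := Nat.cast_nonneg _
    set k : ℝ := ((s / 2 + i : ℕ) : ℝ) with hk
    have hk1 : (s : ℝ) ≤ 2 * (k + 1) := by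
      rw [hk]; exact_mod_cast (by omega : s ≤ 2 * (s / 2 + i + 1))
    have hk2 : 2 * k + 1 ≤ s + 5 * r := by
      rw [hk]; exact_mod_cast (by omega : 2 * (s / 2 + i) + 1 ≤ s + 5 * r)
    have hkey : C1 - C2 ≤ C0 * (10 * r / s) := by
      have h5 : (k + 1) * (C1 - C2) ≤ (k + 1) * (C0 * (10 * r / s)) := by
        rw [hst]
        have h6 : (5 * r : ℝ) ≤ (k + 1) * (10 * r / s) := by
          rw [mul_div_assoc', le_div_iff₀ hspos]
          have : (0 : ℝ) ≤ r := Nat.cast_nonneg _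
          nlinarith
        calc C1 * (2 * k + 1 - s) ≤ C1 * (5 * r) :=
              mul_le_mul_of_nonneg_left (by linarith) hC1
          _ ≤ C0 * (5 * r) := mul_le_mul_of_nonneg_right ha (by positivity)
          _ ≤ C0 * ((k + 1) * (10 * r / s)) :=
              mul_le_mul_of_nonneg_left h6 (hC1.trans ha)
          _ = _ := by ring
      exact le_of_mul_le_mul_left h5 (by positivity)
    push_cast
    linarith

theorem hBaux_diff (s r : ℕ) (hr : 1 ≤ r) (hrs : 40 * r ^ 2 ≤ s) (b : ℕ) (hb : b ≤ r) :
    (b : ℝ) * ((s.choose (s / 2) : ℝ) * (r / s)) ≤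
      s.choose (s / 2 + r) - s.choose (s / 2 + (r + b)) := by
  have hspos : (0 : ℝ) < s := by
    have : 0 < s := by nlinarith
    exact_mod_cast this
  have hr2 : r ≤ r ^ 2 := by nlinarith
  induction b with
  | zero => simp
  | succ b ih =>
    have ih := ih (by omega)
    have hst := hBaux_step s (r + b) (by omega)
    have hlo := hBaux_lower s r hr hrs (r + b) (by omega)
    rw [← add_assoc r b 1]
    set C0 : ℝ := (s.choose (s / 2) : ℝ)
    set C1 : ℝ := (s.choose (s / 2 + (r + b)) : ℝ)
    set C2 : ℝ := (s.choose (s / 2 + (r + b + 1)) : ℝ)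
    have hC0 : 0 ≤ C0 := Nat.cast_nonneg _
    set k : ℝ := ((s / 2 + (r + b) : ℕ) : ℝ) with hk
    have hk1 : (s : ℝ) + 2 * r ≤ 2 * k + 1 := by
      rw [hk]; exact_mod_cast (by omega : s + 2 * r ≤ 2 * (s / 2 + (r + b)) + 1)
    have hk2 : k + 1 ≤ s := by
      rw [hk]; exact_mod_cast (by omega : (s / 2 + (r + b)) + 1 ≤ s)
    have hhalf : C0 / 2 ≤ C1 := by
      refine le_trans ?_ hlo
      have h7 : ((r + b : ℕ) : ℝ) * (10 * r / s) ≤ 1 / 2 := by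
        rw [mul_div_assoc', div_le_iff₀ hspos]
        have h8 : ((r + b : ℕ) : ℝ) ≤ 2 * r := by exact_mod_cast (by omega : r + b ≤ 2 * r)
        have h9 : (40 : ℝ) * r ^ 2 ≤ s := by exact_mod_cast hrs
        have : (0 : ℝ) ≤ r := Nat.cast_nonneg _
        nlinarith
      nlinarith
    have hrn : (0 : ℝ) ≤ r := Nat.cast_nonneg _
    have hk0 : 0 ≤ k := Nat.cast_nonneg _
    have hkey : C0 * (r / s) ≤ C1 - C2 := by
      have h5 : (k + 1) * (C0 * (r / s)) ≤ (k + 1) * (C1 - C2) := by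
        rw [hst]
        have h6 : (k + 1) * (r / s) ≤ (r : ℝ) := by
          rw [mul_div_assoc', div_le_iff₀ hspos]
          nlinarith
        calc (k + 1) * (C0 * (r / s)) = C0 * ((k + 1) * (r / s)) := by ring
          _ ≤ C0 * r := mul_le_mul_of_nonneg_left h6 hC0
          _ = C0 / 2 * (2 * r) := by ring
          _ ≤ C1 * (2 * r) := mul_le_mul_of_nonneg_right hhalf (by positivity)
          _ ≤ _ := mul_le_mul_of_nonneg_left (by linarith) (by linarith)
      exact le_of_mul_le_mul_left h5 (by positivity)
    push_cast
    linarith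

theorem hBaux_chooseHalf (s k : ℕ) (m : ℤ) (h : m = 2 * k) :
    chooseHalf s m = s.choose k := by
  subst h
  unfold chooseHalf
  rw [if_pos ⟨Dvd.intro _ rfl, by positivity⟩]
  have : (2 * (k : ℤ) / 2).toNat = k := by omega
  rw [this]

theorem hB_lower_bound :
    ∃ c : ℝ, 0 < c ∧ ∃ S : ℕ, ∀ s : ℕ, S ≤ s → ∀ B : ℤ, Even B → 2 ≤ B →
      ∃ j : ℤ, c * min (B : ℝ) (Real.sqrt s) / s ≤ |hB s B j| := by
  refine ⟨1 / 392, by norm_num, 49, ?_⟩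
  intro s hs B hBe hB2
  obtain ⟨b', hb'⟩ := hBe
  obtain ⟨b, rfl⟩ : ∃ b : ℕ, b' = b := ⟨b'.toNat, by omega⟩
  have hb1 : 1 ≤ b := by omega
  obtain ⟨r, hr⟩ : ∃ r, r = Nat.sqrt s / 7 := ⟨_, rfl⟩
  have hq1 : Nat.sqrt s * Nat.sqrt s ≤ s := Nat.sqrt_le s
  have hq2 : s < (Nat.sqrt s + 1) * (Nat.sqrt s + 1) := Nat.sqrt_lt.1 (Nat.lt_succ_self _)
  have hq7 : 7 ≤ Nat.sqrt s := Nat.le_sqrt.2 (by omega)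
  have hr1 : 1 ≤ r := by omega
  have hr7 : 7 * r ≤ Nat.sqrt s := by omega
  have hr14 : Nat.sqrt s + 1 ≤ 14 * r := by omega
  have hrs : 40 * r ^ 2 ≤ s := by nlinarith
  have hs14 : s ≤ (14 * r) ^ 2 := by nlinarith
  have hspos : (0 : ℝ) < s := by exact_mod_cast (by omega : 0 < s)
  have hsq : Real.sqrt s ≤ 14 * r := by
    apply Real.sqrt_le_iff.2
    exact ⟨by positivity, by exact_mod_cast hs14⟩
  have hdiff := hBaux_diff s r hr1 hrs (min b r) (min_le_right _ _)
  have hanti : (s.choose (s / 2 + (r + b)) : ℝ) ≤ s.choose (s / 2 + (r + min b r)) :=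
    hBaux_anti s (by omega)
  have hmid : (1 : ℝ) ≤ ((2 : ℝ) ^ s)⁻¹ * s.choose (s / 2) * (2 * Real.sqrt s) := by
    have h1 : ((4 : ℝ)) ^ s ≤ (s.choose (s / 2) : ℝ) ^ 2 * (2 * (s + 1)) := by
      exact_mod_cast hBaux_mid s (by omega)
    have h2 : (2 : ℝ) ^ s ≤ s.choose (s / 2) * (2 * Real.sqrt s) := by
      apply le_of_sq_le_sq _ (by positivity)
      have h3 : Real.sqrt s ^ 2 = s := Real.sq_sqrt hspos.le
      have h4 : ((2 : ℝ) ^ s) ^ 2 = 4 ^ s := by rw [← pow_mul, mul_comm, pow_mul]; norm_num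
      rw [h4, mul_pow, mul_pow, h3]
      refine h1.trans (mul_le_mul_of_nonneg_left ?_ (by positivity))
      have : (49 : ℝ) ≤ s := by exact_mod_cast hs
      linarith
    rw [mul_assoc, inv_mul_eq_div, le_div_iff₀ (by positivity)]
    linarith
  refine ⟨2 * ((s / 2 + (r + b) : ℕ) : ℤ) - s, ?_⟩
  refine le_trans ?_ (le_abs_self _)
  unfold hB
  rw [hBaux_chooseHalf s (s / 2 + r) _ (by push_cast; omega),
    hBaux_chooseHalf s (s / 2 + (r + b)) _ (by push_cast; omega)]
  have hmin : min (B : ℝ) (Real.sqrt s) ≤ 14 * ((min b r : ℕ) : ℝ) := by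
    have hBb : (B : ℝ) = 2 * b := by rw [hb']; push_cast; ring
    rcases le_total b r with h | h
    · rw [min_eq_left h]
      refine (min_le_left _ _).trans ?_
      rw [hBb]
      have : (0 : ℝ) ≤ b := Nat.cast_nonneg _
      linarith
    · rw [min_eq_right h]
      exact (min_le_right _ _).trans hsq
  set P : ℝ := ((2 : ℝ) ^ s)⁻¹ with hP
  have hP0 : 0 < P := by positivity
  set C0 : ℝ := (s.choose (s / 2) : ℝ)
  set t : ℝ := ((min b r : ℕ) : ℝ)
  have ht : 0 ≤ t := Nat.cast_nonneg _
  have hC0 : 0 ≤ C0 := Nat.cast_nonneg _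
  have hPC : 1 ≤ P * C0 * (28 * r) := by
    refine hmid.trans (mul_le_mul_of_nonneg_left (by linarith) (by positivity))
  calc 1 / 392 * min (B : ℝ) (Real.sqrt s) / s ≤ 1 / 392 * (14 * t) / s := by gcongr
    _ = t / (28 * s) * 1 := by field_simp; ring
    _ ≤ t / (28 * s) * (P * C0 * (28 * r)) := mul_le_mul_of_nonneg_left hPC (by positivity)
    _ = P * (t * (C0 * (r / s))) := by field_simp
    _ ≤ _ := mul_le_mul_of_nonneg_left (by linarith) hP0.le
end

section
/- For every integer s ≥ 1 and every even integer B ≥ 2, the function h_B is bimodal along its parity class: there exist integers a ≤ b such that, for integers j ≡ s (mod 2), h_B(j) ≥ h_B(j+2) whenever j+2 ≤ a, h_B(j) ≤ h_B(j+2) whenever a ≤ j and j+2 ≤ b, and h_B(j) ≥ h_B(j+2) whenever b ≤ j. -/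
theorem chooseHalf_nonneg' (s : ℕ) (m : ℤ) : 0 ≤ chooseHalf s m := by
  unfold chooseHalf
  split_ifs <;> positivity

theorem chooseHalf_absorb (s : ℕ) (k : ℤ) :
    ((k : ℝ) + 1) * chooseHalf s (2 * (k + 1)) = ((s : ℝ) - k) * chooseHalf s (2 * k) := by
  rcases lt_trichotomy k (-1) with h | h | h
  · have h1 : ¬ (0 ≤ 2 * (k + 1)) := by omega
    have h2 : ¬ (0 ≤ 2 * k) := by omega
    simp only [chooseHalf, h1, h2, and_false, if_false, mul_zero]
  · subst h
    simp [chooseHalf]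
  · obtain ⟨n, rfl⟩ := Int.eq_ofNat_of_zero_le (show 0 ≤ k by omega)
    have e1 : (2 * ((n : ℤ) + 1) / 2).toNat = n + 1 := by omega
    have e2 : (2 * (n : ℤ) / 2).toNat = n := by omega
    have h1 : 2 ∣ 2 * ((n : ℤ) + 1) ∧ 0 ≤ 2 * ((n : ℤ) + 1) := ⟨by simp, by omega⟩
    have h2 : 2 ∣ 2 * (n : ℤ) ∧ 0 ≤ 2 * (n : ℤ) := ⟨by simp, by omega⟩
    unfold chooseHalf
    rw [if_pos h1, if_pos h2, e1, e2]
    have := Nat.choose_succ_right_eq s n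
    rcases le_total n s with hn | hn
    · have h3 : ((s.choose (n + 1) * (n + 1) : ℕ) : ℝ) = ((s.choose n * (s - n) : ℕ) : ℝ) := by
        rw [this]
      push_cast [Nat.cast_sub hn] at h3
      push_cast
      linarith
    · rcases hn.eq_or_lt with rfl | hn
      · simp
      · simp [Nat.choose_eq_zero_of_lt hn, Nat.choose_eq_zero_of_lt (hn.trans (Nat.lt_succ_self n))]

theorem bimodal_aux (d : ℤ → ℝ) (p q m : ℤ) (hpq : p ≤ q) (hm : 0 ≤ m)
    (h1 : ∀ x y, x ≤ y → y ≤ p → d x ≤ d y)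
    (h2 : ∀ x y, p ≤ x → x ≤ y → y ≤ q → d y ≤ d x)
    (h3 : ∀ x y, q ≤ x → x ≤ y → d x ≤ d y)
    (hp : ∀ x, x ≤ p → 0 ≤ d x) (hq : ∀ x, q ≤ x → d x ≤ 0) :
    ∃ a b : ℤ, a ≤ b ∧ (∀ k, k < a → d (k - m) ≤ d k) ∧
      (∀ k, a ≤ k → k < b → d k ≤ d (k - m)) ∧ (∀ k, b ≤ k → d (k - m) ≤ d k) := by
  have hmax : ∀ x, d x ≤ d p := by
    intro x
    rcases le_total x p with h | h
    · exact h1 _ _ h le_rfl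
    rcases le_total x q with h' | h'
    · exact h2 _ _ le_rfl h h'
    · exact (hq x h').trans (hp p le_rfl)
  have hmin : ∀ x, d q ≤ d x := by
    intro x
    rcases le_total x p with h | h
    · exact (hq q le_rfl).trans (hp x h)
    rcases le_total x q with h' | h'
    · exact h2 _ _ h h' le_rfl
    · exact h3 _ _ le_rfl h'
  obtain ⟨a, ⟨ha1, ha2⟩, ha⟩ := Int.exists_least_of_bdd (P := fun k => p ≤ k ∧ d k ≤ d (k - m))
    ⟨p, fun z hz => hz.1⟩ ⟨q, hpq, hmin _⟩
  obtain ⟨b, ⟨hb1, hb2⟩, hb⟩ := Int.exists_greatest_of_bdd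
    (P := fun k => k ≤ q + m ∧ d k ≤ d (k - m))
    ⟨q + m, fun z hz => hz.1⟩ ⟨p + m, by omega, by simpa using hmax (p + m)⟩
  have haq : a ≤ q := ha q ⟨hpq, hmin _⟩
  have hap : a ≤ p + m := ha (p + m) ⟨by omega, by simpa using hmax (p + m)⟩
  have hbp : p + m ≤ b := hb (p + m) ⟨by omega, by simpa using hmax (p + m)⟩
  refine ⟨a, b + 1, by omega, ?_, ?_, ?_⟩
  · intro k hk
    rcases le_total k p with h | h
    · exact h1 _ _ (by omega) h
    · by_contra hc
      have := ha k ⟨h, (not_le.mp hc).le⟩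
      omega
  · intro k hk hk'
    rcases le_total k q with h | h
    · rcases le_total p (k - m) with h' | h'
      · exact h2 _ _ h' (by omega) h
      · exact (h2 a k ha1 hk h).trans (ha2.trans (h1 _ _ (by omega) h'))
    · rcases le_total (k - m) p with h' | h'
      · exact (hq k h).trans (hp _ h')
      · exact (h3 k b h (by omega)).trans (hb2.trans (h2 _ _ h' (by omega) (by omega)))
  · intro k hk
    rcases le_total (q + m) k with h | h
    · exact h3 _ _ (by omega) (by omega)
    · by_contra hc
      have := hb k ⟨h, (not_le.mp hc).le⟩
      omega

theorem d_identity (s : ℕ) (k : ℤ) :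
    ((s : ℝ) + 1) * (chooseHalf s (2 * (k + 1)) - chooseHalf s (2 * k)) =
      ((s : ℝ) - 2 * k - 1) * (chooseHalf s (2 * k) + chooseHalf s (2 * (k + 1))) := by
  have := chooseHalf_absorb s k
  linear_combination 2 * this

theorem e_identity (s : ℕ) (k : ℤ) :
    ((s : ℝ) + 1) * ((s : ℝ) + 2) * (chooseHalf s (2 * (k + 1 + 1)) - chooseHalf s (2 * (k + 1))
        - (chooseHalf s (2 * (k + 1)) - chooseHalf s (2 * k))) =
      (((s : ℝ) - 2 - 2 * k) ^ 2 - (s + 2)) * (chooseHalf s (2 * k)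
        + 2 * chooseHalf s (2 * (k + 1)) + chooseHalf s (2 * (k + 1 + 1))) := by
  have A := chooseHalf_absorb s k
  have B := chooseHalf_absorb s (k + 1)
  push_cast at B
  generalize chooseHalf s (2 * (k + 1 + 1)) = z at *
  generalize chooseHalf s (2 * (k + 1)) = y at *
  generalize chooseHalf s (2 * k) = x at *
  generalize (s : ℝ) = s at *
  generalize (k : ℝ) = k at *
  have e0 : (s+1)*(s+2)*x = (k+1)*(k+2)*(x+2*y+z) := by
    linear_combination (-(k+2) - (s+1)) * A - (k+1) * B
  have e1 : (s+1)*(s+2)*y = (k+2)*(s-k)*(x+2*y+z) := by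
    linear_combination (k+2) * A - (s-k) * B
  have e2 : (s+1)*(s+2)*z = (s-k)*(s-k-1)*(x+2*y+z) := by
    linear_combination (s-k-1) * A + (s-k+s+1) * B
  linear_combination e0 - 2 * e1 + e2

theorem hB_bimodal (s : ℕ) (hs : 1 ≤ s) (B : ℤ) (hBeven : Even B) (hB2 : 2 ≤ B) :
    ∃ a b : ℤ, a ≤ b ∧ ∀ j : ℤ, j % 2 = (s : ℤ) % 2 →
      (j + 2 ≤ a → hB s B (j + 2) ≤ hB s B j) ∧
      (a ≤ j → j + 2 ≤ b → hB s B j ≤ hB s B (j + 2)) ∧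
      (b ≤ j → hB s B (j + 2) ≤ hB s B j) := by
  obtain ⟨m, hm⟩ := hBeven
  set d : ℤ → ℝ := fun k => chooseHalf s (2 * (k + 1)) - chooseHalf s (2 * k) with hd
  have cn := chooseHalf_nonneg' s
  obtain ⟨r, hr1, hr2⟩ : ∃ r : ℕ, r * r ≤ s + 2 ∧ s + 2 < (r + 1) * (r + 1) :=
    ⟨Nat.sqrt (s + 2), Nat.sqrt_le _, Nat.lt_succ_sqrt _⟩
  have hr1' : (r : ℝ) * r ≤ s + 2 := by exact_mod_cast hr1
  have hr2' : (s : ℝ) + 2 < (r + 1) * (r + 1) := by exact_mod_cast hr2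
  have hs0 : (0 : ℝ) ≤ s := by positivity
  have hr0 : (0 : ℝ) ≤ r := by positivity
  have dpos : ∀ k : ℤ, 2 * k + 1 ≤ s → 0 ≤ d k := by
    intro k hk
    have hk' : 2 * (k : ℝ) + 1 ≤ s := by exact_mod_cast hk
    have h := d_identity s k
    refine nonneg_of_mul_nonneg_right (a := (s : ℝ) + 1) ?_ (by positivity)
    rw [hd]; simp only; rw [h]
    exact mul_nonneg (by linarith) (add_nonneg (cn _) (cn _))
  have dneg : ∀ k : ℤ, (s : ℤ) ≤ 2 * k + 1 → d k ≤ 0 := by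
    intro k hk
    have hk' : (s : ℝ) ≤ 2 * (k : ℝ) + 1 := by exact_mod_cast hk
    have h := d_identity s k
    refine nonpos_of_mul_nonpos_right (a := (s : ℝ) + 1) ?_ (by positivity)
    rw [hd]; simp only; rw [h]
    exact mul_nonpos_of_nonpos_of_nonneg (by linarith) (add_nonneg (cn _) (cn _))
  have Rn : ∀ k : ℤ, 0 ≤ chooseHalf s (2 * k)
        + 2 * chooseHalf s (2 * (k + 1)) + chooseHalf s (2 * (k + 1 + 1)) := by
    intro k
    linarith [cn (2 * k), cn (2 * (k + 1)), cn (2 * (k + 1 + 1))]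
  have epos : ∀ k : ℤ, (s : ℝ) + 2 ≤ ((s : ℝ) - 2 - 2 * k) ^ 2 → d k ≤ d (k + 1) := by
    intro k hk
    rw [← sub_nonneg]
    refine nonneg_of_mul_nonneg_right (a := ((s : ℝ) + 1) * (s + 2)) ?_ (by positivity)
    rw [hd]; simp only; rw [e_identity s k]
    exact mul_nonneg (by linarith) (Rn k)
  have eneg : ∀ k : ℤ, ((s : ℝ) - 2 - 2 * k) ^ 2 ≤ (s : ℝ) + 2 → d (k + 1) ≤ d k := by
    intro k hk
    rw [← sub_nonpos]
    refine nonpos_of_mul_nonpos_right (a := ((s : ℝ) + 1) * (s + 2)) ?_ (by positivity)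
    rw [hd]; simp only; rw [e_identity s k]
    exact mul_nonpos_of_nonpos_of_nonneg (by linarith) (Rn k)
  obtain ⟨p, hp⟩ : ∃ p : ℤ, p = ((s : ℤ) - 1 - r) / 2 := ⟨_, rfl⟩
  obtain ⟨q, hq⟩ : ∃ q : ℤ, q = ((s : ℤ) + r) / 2 := ⟨_, rfl⟩
  obtain ⟨a, b, hab, H1, H2, H3⟩ := bimodal_aux d p q m (by omega) (by omega)
    (by
      intro x y hxy
      induction y, hxy using Int.le_induction with
      | base => intro _; exact le_rfl
      | succ n hn ih =>
        intro h
        refine (ih (by omega)).trans (epos n ?_)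
        have : (r : ℤ) + 1 ≤ s - 2 - 2 * n := by omega
        have : (r : ℝ) + 1 ≤ s - 2 - 2 * n := by exact_mod_cast this
        nlinarith)
    (by
      intro x y hx hxy
      induction y, hxy using Int.le_induction with
      | base => intro _; exact le_rfl
      | succ n hn ih =>
        intro h
        refine (eneg n ?_).trans (ih (by omega))
        have h1 : (s : ℤ) - 2 - 2 * n ≤ r := by omega
        have h2 : -(r : ℤ) ≤ s - 2 - 2 * n := by omega
        have h1 : (s : ℝ) - 2 - 2 * n ≤ r := by exact_mod_cast h1
        have h2 : -(r : ℝ) ≤ s - 2 - 2 * n := by exact_mod_cast h2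
        nlinarith)
    (by
      intro x y hx hxy
      induction y, hxy using Int.le_induction with
      | base => exact le_rfl
      | succ n hn ih =>
        refine ih.trans (epos n ?_)
        have : (s : ℤ) - 2 - 2 * n ≤ -((r : ℤ) + 1) := by omega
        have : (s : ℝ) - 2 - 2 * n ≤ -((r : ℝ) + 1) := by exact_mod_cast this
        nlinarith)
    (fun x hx => dpos x (by omega)) (fun x hx => dneg x (by omega))
  refine ⟨2 * a - s, 2 * b - s, by omega, ?_⟩
  intro j hj
  obtain ⟨k, hk⟩ : ∃ k : ℤ, (s : ℤ) + j = 2 * k := ⟨((s : ℤ) + j) / 2, by omega⟩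
  have key : hB s B (j + 2) - hB s B j = ((2 : ℝ) ^ s)⁻¹ * (d (k - m) - d k) := by
    simp only [hB, hd]
    rw [show (s : ℤ) + (j + 2) - B = 2 * (k - m + 1) by omega,
      show (s : ℤ) + (j + 2) = 2 * (k + 1) by omega,
      show (s : ℤ) + j - B = 2 * (k - m) by omega, hk]
    ring
  have h2s : (0 : ℝ) ≤ ((2 : ℝ) ^ s)⁻¹ := by positivity
  refine ⟨fun h => ?_, fun h h' => ?_, fun h => ?_⟩
  · rw [← sub_nonpos, key]
    exact mul_nonpos_of_nonneg_of_nonpos h2s (sub_nonpos.2 (H1 k (by omega)))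
  · rw [← sub_nonneg, key]
    exact mul_nonneg h2s (sub_nonneg.2 (H2 k (by omega) (by omega)))
  · rw [← sub_nonpos, key]
    exact mul_nonpos_of_nonneg_of_nonpos h2s (sub_nonpos.2 (H3 k (by omega)))
end

section
/- For all positive integers N and T and every function g : {0,…,N−1} × {0,…,T−1} → {0,1}, there exists a finitely supported f_0 : ℤ → ℕ such that, with f_t the state of the liar machine at time t started from f_0, f_t(n) ≡ g(n,t) (mod 2) for all 0 ≤ n < N and 0 ≤ t < T. -/
noncomputable def lmStep (f : ℤ → ℕ) (j : ℤ) : ℕ :=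
  (((f (j - 1) : ℤ) + (f (j + 1) : ℤ) + liarChi f (j - 1) - liarChi f (j + 1)) / 2).toNat

def lmLin (h : ℤ → ℕ) (j : ℤ) : ℕ := h (j - 1) + h (j + 1)

theorem lm_chi_cases (f : ℤ → ℕ) (j : ℤ) :
    (f j % 2 = 0 ∧ liarChi f j = 0) ∨
      (f j % 2 = 1 ∧ (liarChi f j = 1 ∨ liarChi f j = -1)) := by
  unfold liarChi
  split_ifs with h
  · exact Or.inr ⟨Nat.odd_iff.mp h, neg_one_pow_eq_or ℤ _⟩
  · exact Or.inl ⟨Nat.even_iff.mp (Nat.not_odd_iff_even.mp h), rfl⟩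

theorem lm_step_spec (f : ℤ → ℕ) (j : ℤ) :
    (lmStep f j : ℤ) * 2 =
      (f (j - 1) : ℤ) + (f (j + 1) : ℤ) + liarChi f (j - 1) - liarChi f (j + 1) := by
  unfold lmStep
  have h1 := lm_chi_cases f (j - 1)
  have h2 := lm_chi_cases f (j + 1)
  omega

theorem lm_chi_add (f h : ℤ → ℕ) : liarChi (fun j => f j + 2 * h j) = liarChi f := by
  have key : ∀ j, Odd (f j + 2 * h j) ↔ Odd (f j) := by
    intro j
    rw [Nat.odd_iff, Nat.odd_iff]
    omega
  funext j
  simp only [liarChi, key]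

theorem lm_step_add (f h : ℤ → ℕ) :
    lmStep (fun j => f j + 2 * h j) = fun j => lmStep f j + lmLin h j := by
  funext j
  have h1 := lm_step_spec f j
  have h2 := lm_step_spec (fun j => f j + 2 * h j) j
  rw [lm_chi_add] at h2
  simp only [lmLin]
  push_cast at h2
  omega

theorem lm_lin_mul (c : ℕ) (h : ℤ → ℕ) :
    lmLin (fun j => c * h j) = fun j => c * lmLin h j := by
  funext j
  simp only [lmLin]
  ring

theorem lm_lin_iter_mul (t c : ℕ) (h : ℤ → ℕ) :
    lmLin^[t] (fun j => c * h j) = fun j => c * lmLin^[t] h j := by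
  induction t generalizing h with
  | zero => rfl
  | succ t ih => rw [Function.iterate_succ_apply, lm_lin_mul, ih]; rfl

theorem lm_lin_iter_add (t : ℕ) (h k : ℤ → ℕ) :
    lmLin^[t] (fun j => h j + k j) = fun j => lmLin^[t] h j + lmLin^[t] k j := by
  induction t generalizing h k with
  | zero => rfl
  | succ t ih =>
    have : lmLin (fun j => h j + k j) = fun j => lmLin h j + lmLin k j := by
      funext j
      simp only [lmLin]
      ring
    rw [Function.iterate_succ_apply, this, ih]; rfl

theorem lm_iter_add (t : ℕ) (f h : ℤ → ℕ) :
    lmStep^[t] (fun j => f j + 2 ^ t * h j) = fun j => lmStep^[t] f j + lmLin^[t] h j := by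
  induction t generalizing f h with
  | zero => funext j; simp
  | succ t ih =>
    have e : (fun j => f j + 2 ^ (t + 1) * h j) = fun j => f j + 2 * (2 ^ t * h j) := by
      funext j; ring
    rw [Function.iterate_succ_apply, e, lm_step_add f (fun j => 2 ^ t * h j), lm_lin_mul, ih]
    rfl

theorem lm_lin_tri (t : ℕ) (a : ℤ) (h : ℤ → ℕ) (hz : ∀ j < a, h j = 0) :
    (∀ n < a - t, lmLin^[t] h n = 0) ∧ lmLin^[t] h (a - t) = h a := by
  induction t with
  | zero => simpa using hz
  | succ t ih =>
    obtain ⟨i1, i2⟩ := ih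
    simp only [Function.iterate_succ_apply', lmLin]
    push_cast
    refine ⟨fun n hn => ?_, ?_⟩
    · rw [i1 _ (by omega), i1 _ (by omega)]
    · rw [i1 _ (by omega), show a - ((t : ℤ) + 1) + 1 = a - t by ring, i2, zero_add]

theorem lm_surj (t N : ℕ) (p : ℕ → ℕ) :
    ∃ h : ℤ → ℕ, (Function.support h).Finite ∧
      ∀ n < N, lmLin^[t] h (n : ℤ) % 2 = p n % 2 := by
  induction N with
  | zero => exact ⟨fun _ => 0, by simp [Function.support], by simp⟩
  | succ N ih =>
    obtain ⟨h, hf, hp⟩ := ih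
    let k : ℤ → ℕ := fun j => if j = (N : ℤ) + t then lmLin^[t] h (N : ℤ) + p N else 0
    have kz : ∀ j < (N : ℤ) + t, k j = 0 := by
      intro j hj
      simp only [k]
      rw [if_neg (by omega)]
    obtain ⟨k1, k2⟩ := lm_lin_tri t _ k kz
    rw [add_sub_cancel_right] at k1 k2
    refine ⟨fun j => h j + k j, ?_, ?_⟩
    · refine (hf.union (Set.finite_singleton ((N : ℤ) + t))).subset ?_
      intro j hj
      by_contra hc
      simp only [Set.mem_union, Function.mem_support, Set.mem_singleton_iff, not_or,
        not_not] at hc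
      apply hj
      simp [k, hc.1, hc.2]
    · intro n hn
      rw [lm_lin_iter_add]
      rcases Nat.lt_succ_iff_lt_or_eq.mp hn with h1 | rfl
      · simp only [k1 n (by exact_mod_cast h1), add_zero, hp n h1]
      · simp only [k2]
        simp only [k, if_true]
        omega

theorem lm_main (N T : ℕ) (g : ℕ → ℕ → ℕ) :
    ∃ f : ℤ → ℕ, (Function.support f).Finite ∧
      ∀ t < T, ∀ n < N, lmStep^[t] f (n : ℤ) % 2 = g n t % 2 := by
  induction T with
  | zero => exact ⟨fun _ => 0, by simp [Function.support], by simp⟩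
  | succ T ih =>
    obtain ⟨f, hf, hp⟩ := ih
    obtain ⟨h, hh, hq⟩ := lm_surj T N (fun n => lmStep^[T] f (n : ℤ) + g n T)
    refine ⟨fun j => f j + 2 ^ T * h j, ?_, ?_⟩
    · refine (hf.union hh).subset ?_
      intro j hj
      by_contra hc
      simp only [Set.mem_union, Function.mem_support, not_or, not_not] at hc
      apply hj
      simp [hc.1, hc.2]
    · intro t ht n hn
      rcases Nat.lt_succ_iff_lt_or_eq.mp ht with h1 | rfl
      · obtain ⟨d, rfl⟩ := Nat.exists_eq_add_of_lt h1
        have e : (fun j => f j + 2 ^ (t + d + 1) * h j) =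
            fun j => f j + 2 ^ t * (2 * (2 ^ d * h j)) := by
          funext j; ring
        rw [e, lm_iter_add t f (fun j => 2 * (2 ^ d * h j)),
          lm_lin_iter_mul t 2 (fun j => 2 ^ d * h j), ← hp t h1 n hn]
        simp
      · rw [lm_iter_add]
        have := hq n hn
        simp only at this ⊢
        omega

theorem parity_forcing (N T : ℕ) (hN : 0 < N) (hT : 0 < T)
    (g : ℕ → ℕ → ℕ) (hg : ∀ n t, n < N → t < T → g n t ≤ 1) :
    ∃ F : ℕ → ℤ → ℕ, (Function.support (F 0)).Finite ∧ IsLiarEvolution F ∧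
      ∀ n t : ℕ, n < N → t < T → F t (n : ℤ) % 2 = g n t := by
  obtain ⟨f, hf, hp⟩ := lm_main N T g
  refine ⟨fun t => lmStep^[t] f, hf, ?_, ?_⟩
  · intro t j
    simp only [Function.iterate_succ_apply']
    exact lm_step_spec _ j
  · intro n t hn ht
    have h1 := hp t ht n hn
    have h2 := hg n t hn ht
    simp only
    omega
end

section
/- There exists a constant c > 0 such that for every integer T ≥ 2 and every N ∈ ℤ, there is a finitely supported f_0 : ℤ → ℕ such that, letting g_0 equal f_0 (viewed as a function ℤ → ℝ) and letting f_t and g_t evolve under the liar machine and the linear machine respectively, |f_T(N) − g_T(N)| ≥ c·log T, where log denotes the natural logarithm. -/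
/-! Existence of the evolution -/

lemma liarChi_of_even {f : ℤ → ℕ} {j : ℤ} (h : ¬ Odd (f j)) : liarChi f j = 0 := by
  simp [liarChi, h]

lemma liarChi_cases (f : ℤ → ℕ) (j : ℤ) :
    (Odd (f j) ∧ (liarChi f j = 1 ∨ liarChi f j = -1)) ∨ (¬ Odd (f j) ∧ liarChi f j = 0) := by
  by_cases h : Odd (f j)
  · left
    refine ⟨h, ?_⟩
    simp only [liarChi, h, if_true]
    exact neg_one_pow_eq_or ℤ _
  · right
    exact ⟨h, liarChi_of_even h⟩

lemma liarChi_congr {f g : ℤ → ℕ} (h : ∀ i, Odd (f i) ↔ Odd (g i)) (j : ℤ) :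
    liarChi f j = liarChi g j := by
  simp [liarChi, h]

noncomputable def liarStep (f : ℤ → ℕ) (j : ℤ) : ℕ :=
  (((f (j - 1) : ℤ) + (f (j + 1) : ℤ) + liarChi f (j - 1) - liarChi f (j + 1)) / 2).toNat

lemma liarStep_spec (f : ℤ → ℕ) (j : ℤ) :
    (liarStep f j : ℤ) * 2 =
      (f (j - 1) : ℤ) + (f (j + 1) : ℤ) + liarChi f (j - 1) - liarChi f (j + 1) := by
  unfold liarStep
  have h1 := liarChi_cases f (j - 1)
  have h2 := liarChi_cases f (j + 1)
  simp only [Nat.odd_iff] at h1 h2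
  omega

noncomputable def liarEv (f : ℤ → ℕ) : ℕ → ℤ → ℕ
  | 0 => f
  | t + 1 => liarStep (liarEv f t)

lemma liarEv_spec (f : ℤ → ℕ) : IsLiarEvolution (liarEv f) := fun t j => liarStep_spec _ _

lemma liarEv_supp (f : ℤ → ℕ) (B : ℤ) (h : ∀ i < B, f i = 0) (s : ℕ) :
    ∀ i < B - s, liarEv f s i = 0 := by
  induction s with
  | zero => intro i hi; exact h i (by simpa using hi)
  | succ s ih =>
    intro i hi
    push_cast at hi
    have e := liarEv_spec f s i
    have h1 := ih (i - 1) (by omega)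
    have h2 := ih (i + 1) (by omega)
    have h3 := liarChi_of_even (f := liarEv f s) (j := i - 1) (by simp [h1])
    have h4 := liarChi_of_even (f := liarEv f s) (j := i + 1) (by simp [h2])
    rw [h1, h2, h3, h4] at e
    omega

/-! Perturbation -/

def walkN (y : ℤ) : ℕ → ℤ → ℕ
  | 0 => fun i => if i = y then 1 else 0
  | s + 1 => fun i => walkN y s (i - 1) + walkN y s (i + 1)

lemma walkN_lt (y : ℤ) (s : ℕ) : ∀ i < y - s, walkN y s i = 0 := by
  induction s with
  | zero => intro i hi; simp at hi; simp [walkN, hi.ne]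
  | succ s ih =>
    intro i hi
    push_cast at hi
    simp [walkN, ih (i - 1) (by omega), ih (i + 1) (by omega)]

lemma walkN_eq (y : ℤ) (s : ℕ) : walkN y s (y - s) = 1 := by
  induction s with
  | zero => simp [walkN]
  | succ s ih =>
    have : y - ((s + 1 : ℕ) : ℤ) + 1 = y - s := by push_cast; ring
    simp only [walkN]
    rw [this, ih, walkN_lt y s _ (by push_cast; omega)]

lemma perturb (f : ℤ → ℕ) (y : ℤ) (t : ℕ) (s : ℕ) (hs : s ≤ t) :
    ∀ i, liarEv (fun i => f i + 2 ^ t * walkN y 0 i) s i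
      = liarEv f s i + 2 ^ (t - s) * walkN y s i := by
  induction s with
  | zero => intro i; simp [liarEv]
  | succ s ih =>
    have ih := ih (by omega)
    intro i
    have hp : 2 ^ (t - s) = 2 * 2 ^ (t - (s + 1)) := by
      rw [← pow_succ']; congr 1; omega
    have hc := liarChi_congr (f := liarEv (fun i => f i + 2 ^ t * walkN y 0 i) s)
      (g := liarEv f s) (by
        intro i
        rw [ih i, hp, mul_assoc]
        simp only [Nat.odd_iff]
        omega)
    have e1 := liarEv_spec f s i
    have e2 := liarEv_spec (fun i => f i + 2 ^ t * walkN y 0 i) s i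
    rw [hc, hc, ih, ih, hp] at e2
    have : (walkN y (s + 1) i) = walkN y s (i - 1) + walkN y s (i + 1) := rfl
    rw [this]
    zify
    push_cast at e2
    linarith

/-! Parity forcing -/

lemma forcing (P : ℕ → ℤ → Prop) (B M : ℤ) (hP : ∀ s i, P s i → B - s ≤ i) (t : ℕ) :
    ∃ f : ℤ → ℕ, (Function.support f).Finite ∧ (∀ i < B, f i = 0) ∧
      ∀ s < t, ∀ i ≤ M, (Odd (liarEv f s i) ↔ P s i) := by
  induction t with
  | zero => exact ⟨fun _ => 0, by simp, by simp, by simp⟩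
  | succ t ih =>
    have key : ∀ n : ℕ, ∃ f : ℤ → ℕ, (Function.support f).Finite ∧ (∀ i < B, f i = 0) ∧
      (∀ s < t, ∀ i ≤ M, (Odd (liarEv f s i) ↔ P s i)) ∧
      (∀ i < B - t + n, (Odd (liarEv f t i) ↔ P t i)) := by
      intro n
      induction n with
      | zero =>
        obtain ⟨f, h1, h2, h3⟩ := ih
        refine ⟨f, h1, h2, h3, ?_⟩
        intro i hi
        simp at hi
        rw [liarEv_supp f B h2 t i hi]
        have : ¬ P t i := fun h => by have := hP t i h; omega
        simp [this]
      | succ n ihn =>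
        obtain ⟨f, h1, h2, h3, h4⟩ := ihn
        by_cases hn : Odd (liarEv f t (B - t + n)) ↔ P t (B - t + n)
        · refine ⟨f, h1, h2, h3, ?_⟩
          intro i hi
          push_cast at hi
          rcases (show i < B - t + n ∨ i = B - t + n by omega) with h | h
          · exact h4 i h
          · rw [h]; exact hn
        · refine ⟨fun i => f i + 2 ^ t * walkN (B + n) 0 i, ?_, ?_, ?_, ?_⟩
          · refine (h1.union (Set.finite_singleton (B + n))).subset ?_
            intro i hi
            by_contra hc
            simp at hc
            simp [walkN, hc] at hi
          · intro i hi
            have : i ≠ B + n := by omega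
            simp [walkN, h2 i hi, this]
          · intro s hs i hi
            rw [perturb f _ t s hs.le, ← h3 s hs i hi]
            have hp : 2 ^ (t - s) = 2 * 2 ^ (t - s - 1) := by
              rw [← pow_succ']; congr 1; omega
            rw [hp, mul_assoc]
            simp only [Nat.odd_iff]
            omega
          · intro i hi
            push_cast at hi
            rw [perturb f _ t t le_rfl]
            rcases (show i < B - t + n ∨ i = B - t + n by omega) with h | h
            · rw [walkN_lt _ _ _ (by omega), ← h4 i h]; simp
            · have : i = B + n - t := by omega
              rw [← h] at hn
              have e : walkN (B + n) t i = 1 := by rw [this]; exact walkN_eq _ _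
              rw [e]
              simp only [Nat.sub_self, pow_zero, mul_one]
              rw [Nat.odd_add_one]
              tauto
    obtain ⟨f, h1, h2, h3, h4⟩ := key (M - B + t + 1).toNat
    refine ⟨f, h1, h2, ?_⟩
    intro s hs i hi
    rcases (show s < t ∨ s = t by omega) with h | h
    · exact h3 s h i hi
    · subst h; exact h4 i (by omega)

/-! Linear operator -/

noncomputable def Lop (h : ℤ → ℝ) (j : ℤ) : ℝ := (h (j - 1) + h (j + 1)) / 2

noncomputable def Wop (N : ℤ) : ℕ → (ℤ → ℝ) → ℝ
  | 0 => fun h => h N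
  | s + 1 => fun h => Wop N s (Lop h)

lemma Wop_add (N : ℤ) (s : ℕ) : ∀ h k : ℤ → ℝ, Wop N s (fun j => h j + k j) = Wop N s h + Wop N s k := by
  induction s with
  | zero => intro h k; rfl
  | succ s ih =>
    intro h k
    simp only [Wop]
    rw [← ih]
    congr 1
    ext j
    simp only [Lop]; ring

lemma Wop_zero (N : ℤ) (s : ℕ) : Wop N s (fun _ => 0) = 0 := by
  have := Wop_add N s (fun _ => 0) (fun _ => 0)
  simp at this
  linarith

lemma Wop_eq (N : ℤ) (s : ℕ) : ∀ h : ℤ → ℝ,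
    Wop N s h = (∑ k ∈ Finset.range (s + 1), (s.choose k : ℝ) * h (N + s - 2 * k)) / 2 ^ s := by
  induction s with
  | zero => intro h; simp [Wop]
  | succ s ih =>
    intro h
    simp only [Wop]
    rw [ih, pow_succ, div_eq_div_iff (by positivity) (by positivity)]
    have e : ∑ k ∈ Finset.range (s + 1 + 1), ((s + 1).choose k : ℝ) * h (N + (s + 1 : ℕ) - 2 * k)
        = ∑ k ∈ Finset.range (s + 1), (s.choose k : ℝ) * h (N + s - 2 * k - 1) +
          ∑ k ∈ Finset.range (s + 1), (s.choose k : ℝ) * h (N + s - 2 * k + 1) := by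
      rw [Finset.sum_range_succ']
      have e2 : ∑ k ∈ Finset.range (s + 1), (s.choose k : ℝ) * h (N + s - 2 * k + 1)
        = ∑ k ∈ Finset.range (s + 1), (s.choose (k + 1) : ℝ) * h (N + s - 2 * k - 1)
          + h (N + s + 1) := by
        rw [Finset.sum_range_succ', Finset.sum_range_succ (n := s)]
        simp only [Nat.choose_succ_self, Nat.choose_zero_right]
        push_cast
        rw [zero_mul, add_zero, one_mul]
        congr 1
        · apply Finset.sum_congr rfl
          intro k _
          congr 2; ring
        · congr 1; ring
      rw [e2, ← add_assoc, ← Finset.sum_add_distrib]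
      congr 1
      · apply Finset.sum_congr rfl
        intro k _
        rw [Nat.choose_succ_succ]
        have : N + ((s + 1 : ℕ) : ℤ) - 2 * ((k + 1 : ℕ) : ℤ) = N + s - 2 * k - 1 := by
          push_cast; ring
        rw [this]; push_cast; ring
      · simp; congr 1; ring
    rw [e, ← Finset.sum_add_distrib]
    have : ∑ k ∈ Finset.range (s + 1), (s.choose k : ℝ) * Lop h (N + s - 2 * k) =
      (∑ k ∈ Finset.range (s + 1), ((s.choose k : ℝ) * h (N + s - 2 * k - 1) + (s.choose k : ℝ) * h (N + s - 2 * k + 1))) / 2 := by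
      rw [Finset.sum_div]
      apply Finset.sum_congr rfl
      intro k _
      simp only [Lop]; ring
    rw [this]; ring

lemma Wop_congr (N : ℤ) (s : ℕ) (h k : ℤ → ℝ) (e : ∀ i ≤ N + s, h i = k i) :
    Wop N s h = Wop N s k := by
  rw [Wop_eq, Wop_eq]
  congr 1
  apply Finset.sum_congr rfl
  intro i _
  rw [e _ (by omega)]

lemma err_eq_s8 (N : ℤ) (T : ℕ) (e d : ℕ → ℤ → ℝ) (h0 : ∀ j, e 0 j = 0)
    (h : ∀ t j, e (t + 1) j = (e t (j - 1) + e t (j + 1)) / 2 + d t j) :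
    e T N = ∑ t ∈ Finset.range T, Wop N (T - 1 - t) (d t) := by
  have key : ∀ t ≤ T, Wop N (T - t) (e t) = ∑ u ∈ Finset.range t, Wop N (T - 1 - u) (d u) := by
    intro t
    induction t with
    | zero =>
      intro _
      have : e 0 = fun _ => 0 := funext h0
      rw [this, Wop_zero]; simp
    | succ t ih =>
      intro ht
      rw [Finset.sum_range_succ, ← ih (by omega)]
      have : e (t + 1) = fun j => Lop (e t) j + d t j := funext (h t)
      rw [this, Wop_add]
      have h1 : T - t = (T - (t + 1)) + 1 := by omega
      have h2 : T - 1 - t = T - (t + 1) := by omega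
      rw [h1, h2]
      rfl
  have := key T le_rfl
  simpa [Wop] using this

/-! Binomial estimates -/

lemma central_lb (m : ℕ) : (16 : ℝ) ^ m ≤ 4 * (m + 1) * ((2 * m).choose m : ℝ) ^ 2 := by
  have key : ∀ m : ℕ, (16 : ℝ) ^ m * (m + 1) ≤ 4 * (m + 1) * (m + 1) * (m.centralBinom : ℝ) ^ 2 := by
    intro m
    have : ∀ m : ℕ, 1 ≤ m → (16 : ℝ) ^ m ≤ 4 * m * (m.centralBinom : ℝ) ^ 2 := by
      intro m hm
      induction m, hm using Nat.le_induction with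
      | base => norm_num [Nat.centralBinom]
      | succ n hn ih =>
        have e := Nat.succ_mul_centralBinom_succ n
        have e' : ((n : ℝ) + 1) * ((n + 1).centralBinom : ℝ) = 2 * (2 * n + 1) * (n.centralBinom : ℝ) := by
          exact_mod_cast e
        set x := ((n + 1).centralBinom : ℝ)
        set y := (n.centralBinom : ℝ)
        have hn0 : (0 : ℝ) < n + 1 := by positivity
        push_cast
        have : ((n : ℝ) + 1) * 16 ^ (n + 1) ≤ (n + 1) * (4 * (n + 1) * x ^ 2) := by
          calc ((n : ℝ) + 1) * 16 ^ (n + 1) = 16 * (n + 1) * 16 ^ n := by ring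
            _ ≤ 16 * (n + 1) * (4 * n * y ^ 2) := by gcongr
            _ ≤ 4 * (2 * (2 * n + 1) * y) ^ 2 := by nlinarith [sq_nonneg y]
            _ = (n + 1) * (4 * (n + 1) * x ^ 2) := by rw [← e']; ring
        exact le_of_mul_le_mul_left this hn0
    rcases Nat.eq_zero_or_pos m with h | h
    · subst h; norm_num
    · have h1 := this m h
      have : (0 : ℝ) ≤ (m.centralBinom : ℝ) ^ 2 := by positivity
      have hm : (0 : ℝ) < m + 1 := by positivity
      nlinarith
  have hm : (0 : ℝ) < m + 1 := by positivity
  have := key m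
  rw [Nat.centralBinom_eq_two_mul_choose] at this
  nlinarith

lemma choose_step (m k : ℕ) : ((2 * m).choose (m + k + 1) : ℝ) * (m + k + 1) =
    ((2 * m).choose (m + k) : ℝ) * (m - k) := by
  rcases le_or_gt k m with h | h
  · have := Nat.choose_succ_right_eq (2 * m) (m + k)
    have h2 : 2 * m - (m + k) = m - k := by omega
    rw [h2] at this
    have := congrArg (Nat.cast (R := ℝ)) this
    push_cast [Nat.cast_sub h] at this
    exact this
  · rw [Nat.choose_eq_zero_of_lt (by omega), Nat.choose_eq_zero_of_lt (by omega)]; simp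

lemma choose_off (m k : ℕ) (hk : k * k ≤ m) :
    ((2 * m).choose m : ℝ) * (m + 1 - k ^ 2) ≤ ((2 * m).choose (m + k) : ℝ) * (m + 1) := by
  induction k with
  | zero => simp
  | succ k ih =>
    have ih := ih (by nlinarith)
    have e := choose_step m k
    have hk' : ((k : ℝ) + 1) * (k + 1) ≤ m := by exact_mod_cast hk
    have hc : (0 : ℝ) ≤ ((2 * m).choose m : ℝ) := by positivity
    rw [← add_assoc]
    push_cast
    set a := ((2 * m).choose m : ℝ)
    set b := ((2 * m).choose (m + k) : ℝ)
    set c := ((2 * m).choose (m + k + 1) : ℝ)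
    have hk0 : (0 : ℝ) ≤ k := by positivity
    have hm0 : (0 : ℝ) ≤ m := by positivity
    have h1 : a * (m + 1 - (k + 1) ^ 2) * (m + k + 1) ≤ c * (m + 1) * (m + k + 1) := by
      have h2 : c * (m + 1) * (m + k + 1) = b * (m + 1) * (m - k) := by linear_combination (m + 1) * e
      rw [h2]
      have h3 : a * (m + 1 - k ^ 2) * (m - k) ≤ b * (m + 1) * (m - k) := by
        apply mul_le_mul_of_nonneg_right ih; nlinarith
      refine le_trans ?_ h3
      rw [mul_assoc, mul_assoc]
      apply mul_le_mul_of_nonneg_left _ hc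
      have : ((m : ℝ) + 1 - k ^ 2) * (m - k) - (m + 1 - (k + 1) ^ 2) * (m + k + 1) = (2 * k + 1) * (k ^ 2 + k) := by ring
      have : (0 : ℝ) ≤ (2 * k + 1) * (k ^ 2 + k) := by positivity
      linarith
    exact le_of_mul_le_mul_right h1 (by positivity)

lemma diff_lb (m : ℕ) : 1 / (16 * ((m : ℝ) + 1)) ≤
    (((2 * m).choose (m + Nat.sqrt (m / 2)) : ℝ) - ((2 * m).choose (m + Nat.sqrt (m / 2) + 1) : ℝ)) / 2 ^ (2 * m) := by
  obtain ⟨k, hk⟩ : ∃ k, k = Nat.sqrt (m / 2) := ⟨_, rfl⟩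
  rw [← hk]
  have h1 : k * k ≤ m / 2 := hk ▸ Nat.sqrt_le _
  have h2 : m / 2 < (k + 1) * (k + 1) := hk ▸ Nat.lt_succ_sqrt _
  have h1' : 2 * (k * k) ≤ m := by omega
  have h2' : m + 1 ≤ 2 * ((k + 1) * (k + 1)) := by omega
  have hkm : k ≤ m := by nlinarith
  have r1 : 2 * ((k : ℝ) * k) ≤ m := by exact_mod_cast h1'
  have r2 : (m : ℝ) + 1 ≤ 2 * ((k + 1) * (k + 1)) := by exact_mod_cast h2'
  have r3 : (k : ℝ) ≤ m := by exact_mod_cast hkm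
  have o := choose_off m k (by omega)
  have e := choose_step m k
  have cl := central_lb m
  have hp : (2 : ℝ) ^ (2 * m) = 4 ^ m := by rw [pow_mul]; norm_num
  have h16 : (16 : ℝ) ^ m = (4 ^ m) ^ 2 := by rw [← pow_mul, mul_comm m 2, pow_mul]; norm_num
  rw [hp]
  rw [h16] at cl
  have ha : (0 : ℝ) ≤ ((2 * m).choose m : ℝ) := by positivity
  set a := ((2 * m).choose m : ℝ)
  set b := ((2 * m).choose (m + k) : ℝ)
  set c := ((2 * m).choose (m + k + 1) : ℝ)
  have hq : (0 : ℝ) < 4 ^ m := by positivity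
  set q := (4 : ℝ) ^ m
  have hk0 : (0 : ℝ) ≤ k := by positivity
  have hm0 : (0 : ℝ) ≤ m := by positivity
  -- b ≥ a/2
  have hb : a ≤ 2 * b := by
    have : a * (m + 1) ≤ 2 * b * (m + 1) := by nlinarith
    exact le_of_mul_le_mul_right this (by positivity)
  -- (b - c) (m+k+1) = b (2k+1)
  have hd : (b - c) * (m + k + 1) = b * (2 * k + 1) := by linear_combination -e
  have hbc : 0 ≤ b - c := by
    by_contra hneg
    push Not at hneg
    have : (b - c) * (m + k + 1) < 0 := mul_neg_of_neg_of_pos hneg (by positivity)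
    have : 0 ≤ b * (2 * k + 1) := by apply mul_nonneg <;> linarith
    linarith
  have hd2 : a * (k + 1) ≤ 4 * ((b - c) * (m + 1)) := by nlinarith
  -- q ≤ 4 * a * (k+1)
  have hq2 : q ≤ 4 * (a * (k + 1)) := by
    apply le_of_sq_le_sq _ (by positivity)
    nlinarith [mul_le_mul_of_nonneg_right r2 (sq_nonneg a), mul_nonneg (sq_nonneg a) (sq_nonneg ((k : ℝ) + 1))]
  rw [div_le_div_iff₀ (by positivity) hq]
  linarith

theorem liar_machine_pointwise_lower_bound :
    ∃ c : ℝ, 0 < c ∧ ∀ T : ℕ, 2 ≤ T → ∀ N : ℤ,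
      ∃ (F : ℕ → ℤ → ℕ) (G : ℕ → ℤ → ℝ),
        (Function.support (F 0)).Finite ∧ IsLiarEvolution F ∧ IsLinearEvolution G ∧
        (∀ j : ℤ, G 0 j = (F 0 j : ℝ)) ∧
        c * Real.log T ≤ |(F T N : ℝ) - G T N| := by
  refine ⟨1 / 64, by norm_num, ?_⟩
  intro T hT N
  obtain ⟨f, hf, -, hpar⟩ := forcing
    (fun t j => ∃ m : ℕ, T = t + 1 + 2 * m ∧ j = N - (2 * (Nat.sqrt (m / 2) : ℤ) + 1))
    (N - T) (N + T + 1) (by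
      rintro s i ⟨m, h1, rfl⟩
      have : Nat.sqrt (m / 2) ≤ m := (Nat.sqrt_le_self _).trans (Nat.div_le_self _ _)
      omega) T
  refine ⟨liarEv f, fun t => Lop^[t] (fun j => (f j : ℝ)), hf, liarEv_spec f, ?_, ?_, ?_⟩
  · intro t j
    simp only [Function.iterate_succ_apply']
    rfl
  · intro j; rfl
  refine le_trans ?_ (le_abs_self _)
  have E := err_eq_s8 N T (fun t j => (liarEv f t j : ℝ) - Lop^[t] (fun j => (f j : ℝ)) j)
    (fun t j => ((liarChi (liarEv f t) (j - 1) : ℝ) - (liarChi (liarEv f t) (j + 1) : ℝ)) / 2)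
    (by intro j; simp [liarEv])
    (by
      intro t j
      have := liarEv_spec f t j
      have := congrArg (Int.cast (R := ℝ)) this
      push_cast at this
      simp only [Function.iterate_succ_apply']
      simp only [Lop]
      linarith)
  rw [E, ← Finset.sum_range_reflect]
  have hterm : ∀ s < T, Wop N s (fun j => ((liarChi (liarEv f (T - 1 - s)) (j - 1) : ℝ)
      - (liarChi (liarEv f (T - 1 - s)) (j + 1) : ℝ)) / 2) ≥
      if Even s then 1 / (32 * (((s / 2 : ℕ) : ℝ) + 1)) else 0 := by
    intro s hs
    have hp := hpar (T - 1 - s) (by omega)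
    split_ifs with hev
    · obtain ⟨m, hm⟩ := hev
      have hm2 : s = 2 * m := by omega
      have hsm : s / 2 = m := by omega
      rw [hsm]
      have hp' : ∀ i ≤ N + T + 1, (Odd (liarEv f (T - 1 - s) i) ↔
          i = N - (2 * (Nat.sqrt (m / 2) : ℤ) + 1)) := by
        intro i hi
        rw [hp i hi]
        constructor
        · rintro ⟨m', h1, h2⟩
          have : m' = m := by omega
          rw [← this]; exact h2
        · intro h
          exact ⟨m, by omega, h⟩
      have hchi : ∀ i ≤ N + T + 1, liarChi (liarEv f (T - 1 - s)) i =
          if i = N - (2 * (Nat.sqrt (m / 2) : ℤ) + 1) then 1 else 0 := by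
        intro i hi
        by_cases h : i = N - (2 * (Nat.sqrt (m / 2) : ℤ) + 1)
        · have ho := (hp' i hi).2 h
          have hempty : {i' : ℤ | i' < i ∧ Odd (liarEv f (T - 1 - s) i')} = ∅ := by
            ext i'
            simp only [Set.mem_ofPred_eq, Set.mem_empty_iff_false, iff_false, not_and]
            intro hlt ho'
            have := (hp' i' (by omega)).1 ho'
            omega
          rw [liarChi, if_pos ho, hempty, if_pos h]; simp
        · rw [if_neg h]
          exact liarChi_of_even (fun ho => h ((hp' i hi).1 ho))
      have hW := Wop_congr N s (fun j => ((liarChi (liarEv f (T - 1 - s)) (j - 1) : ℝ)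
          - (liarChi (liarEv f (T - 1 - s)) (j + 1) : ℝ)) / 2)
          (fun j => ((if j - 1 = N - (2 * (Nat.sqrt (m / 2) : ℤ) + 1) then (1 : ℝ) else 0)
            - (if j + 1 = N - (2 * (Nat.sqrt (m / 2) : ℤ) + 1) then (1 : ℝ) else 0)) / 2) (by
          intro i hi
          rw [hchi _ (by omega), hchi _ (by omega)]
          push_cast
          rfl)
      rw [hW, Wop_eq, hm2]
      have hd := diff_lb m
      have hkm : Nat.sqrt (m / 2) ≤ m := (Nat.sqrt_le_self _).trans (Nat.div_le_self _ _)
      set k := Nat.sqrt (m / 2)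
      have hsum : ∑ x ∈ Finset.range (2 * m + 1), ((2 * m).choose x : ℝ) *
          (((if N + ((2 * m : ℕ) : ℤ) - 2 * (x : ℤ) - 1 = N - (2 * (k : ℤ) + 1) then (1 : ℝ) else 0)
            - (if N + ((2 * m : ℕ) : ℤ) - 2 * (x : ℤ) + 1 = N - (2 * (k : ℤ) + 1) then (1 : ℝ) else 0)) / 2)
          = (((2 * m).choose (m + k) : ℝ) - ((2 * m).choose (m + k + 1) : ℝ)) / 2 := by
        have c1 : ∀ x : ℕ, (N + ((2 * m : ℕ) : ℤ) - 2 * (x : ℤ) - 1 = N - (2 * (k : ℤ) + 1)) ↔ x = m + k := by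
          intro x; omega
        have c2 : ∀ x : ℕ, (N + ((2 * m : ℕ) : ℤ) - 2 * (x : ℤ) + 1 = N - (2 * (k : ℤ) + 1)) ↔ x = m + k + 1 := by
          intro x; omega
        simp only [c1, c2]
        have : ∀ x : ℕ, ((2 * m).choose x : ℝ) * (((if x = m + k then (1 : ℝ) else 0) -
            (if x = m + k + 1 then (1 : ℝ) else 0)) / 2) =
            (if x = m + k then ((2 * m).choose x : ℝ) / 2 else 0)
            - (if x = m + k + 1 then ((2 * m).choose x : ℝ) / 2 else 0) := by
          intro x; split_ifs <;> ring
        simp only [this]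
        rw [Finset.sum_sub_distrib, Finset.sum_ite_eq', Finset.sum_ite_eq',
          if_pos (by simp; omega)]
        split_ifs with hh
        · ring
        · rw [Nat.choose_eq_zero_of_lt (by simp at hh; omega : 2 * m < m + k + 1)]; simp
      rw [hsum]
      calc 1 / (32 * ((m : ℝ) + 1)) = (1 / (16 * ((m : ℝ) + 1))) / 2 := by
            field_simp; norm_num
        _ ≤ _ := by
            refine (div_le_div_of_nonneg_right hd (by norm_num : (0 : ℝ) ≤ 2)).trans (le_of_eq ?_)
            ring
    · have hchi : ∀ i ≤ N + T + 1, liarChi (liarEv f (T - 1 - s)) i = 0 := by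
        intro i hi
        apply liarChi_of_even
        rw [hp i hi]
        rintro ⟨m, h1, -⟩
        exact hev ⟨m, by omega⟩
      have hW := Wop_congr N s (fun j => ((liarChi (liarEv f (T - 1 - s)) (j - 1) : ℝ)
          - (liarChi (liarEv f (T - 1 - s)) (j + 1) : ℝ)) / 2) (fun _ => 0) (by
          intro i hi
          rw [hchi _ (by omega), hchi _ (by omega)]
          simp)
      rw [hW, Wop_zero]
  have hsum2 : ∀ n : ℕ, ∑ s ∈ Finset.range n, (if Even s then 1 / (32 * (((s / 2 : ℕ) : ℝ) + 1)) else 0)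
      = (1 / 32) * ((harmonic ((n + 1) / 2) : ℚ) : ℝ) := by
    intro n
    induction n with
    | zero => simp
    | succ n ih =>
      rw [Finset.sum_range_succ, ih]
      split_ifs with h
      · obtain ⟨m, hm⟩ := h
        have e1 : (n + 1 + 1) / 2 = m + 1 := by omega
        have e2 : (n + 1) / 2 = m := by omega
        have e3 : n / 2 = m := by omega
        rw [e1, e2, e3, harmonic_succ]
        push_cast
        field_simp
      · rw [Nat.not_even_iff] at h
        have e1 : (n + 1 + 1) / 2 = (n + 1) / 2 := by omega
        rw [e1, add_zero]
  have hlog : Real.log T ≤ 2 * ((harmonic ((T + 1) / 2) : ℚ) : ℝ) := by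
    have h1 := log_add_one_le_harmonic ((T + 1) / 2)
    have hMn : T ≤ 2 * ((T + 1) / 2) := by omega
    have hM : (T : ℝ) ≤ 2 * (((T + 1) / 2 : ℕ) : ℝ) := by exact_mod_cast hMn
    have hTpos : (0 : ℝ) < T := by positivity
    have h2 : Real.log T ≤ 2 * Real.log ((((T + 1) / 2 + 1 : ℕ)) : ℝ) := by
      rw [← Real.log_rpow (by positivity)]
      apply Real.log_le_log hTpos
      rw [Real.rpow_two]
      push_cast
      nlinarith [sq_nonneg ((((T + 1) / 2 : ℕ)) : ℝ)]
    linarith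
  calc 1 / 64 * Real.log T ≤ (1 / 32) * ((harmonic ((T + 1) / 2) : ℚ) : ℝ) := by linarith
    _ = _ := (hsum2 T).symm
    _ ≤ _ := by
      apply Finset.sum_le_sum
      intro s hs
      have hs := Finset.mem_range.1 hs
      have h := hterm s hs
      have e : T - 1 - (T - 1 - s) = s := by omega
      rw [e]
      exact h
end

section
/- There exists a constant c > 0 such that for every integer T ≥ 2 and all integers a < b, writing I = {a, a+1, …, b} and B = b − a, there is a finitely supported f_0 : ℤ → ℕ such that, letting g_0 equal f_0 (viewed as a function ℤ → ℝ) and letting f_t and g_t evolve under the liar machine and the linear machine respectively: if B > √T/2 then |f_T(I) − g_T(I)| ≥ c·√T, and if B ≤ √T/2 then |f_T(I) − g_T(I)| ≥ c·B·log(T/B²), where log denotes the natural logarithm. -/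
namespace LiarAux

theorem chi_abs_le (f : ℤ → ℕ) (j : ℤ) : |liarChi f j| ≤ (f j : ℤ) := by
  unfold liarChi
  split_ifs with h
  · have : 0 < f j := h.pos
    rw [abs_pow, abs_neg, abs_one, one_pow]
    omega
  · simp

theorem chi_parity (f : ℤ → ℕ) (j : ℤ) : Even ((f j : ℤ) + liarChi f j) := by
  unfold liarChi
  split_ifs with h
  · have h1 : Odd ((f j : ℕ) : ℤ) := by exact_mod_cast h
    exact h1.add_odd (Odd.pow (by decide))
  · have : Even (f j) := Nat.not_odd_iff_even.mp h
    simpa using this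

noncomputable def lstep (f : ℤ → ℕ) (j : ℤ) : ℕ :=
  (((f (j - 1) : ℤ) + (f (j + 1) : ℤ) + liarChi f (j - 1) - liarChi f (j + 1)) / 2).toNat

theorem lstep_spec (f : ℤ → ℕ) (j : ℤ) : (lstep f j : ℤ) * 2 =
    (f (j - 1) : ℤ) + (f (j + 1) : ℤ) + liarChi f (j - 1) - liarChi f (j + 1) := by
  unfold lstep
  have h1 := abs_le.mp (chi_abs_le f (j - 1))
  have h2 := abs_le.mp (chi_abs_le f (j + 1))
  obtain ⟨r1, hr1⟩ := chi_parity f (j - 1)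
  obtain ⟨r2, hr2⟩ := chi_parity f (j + 1)
  omega

noncomputable def ev (f : ℤ → ℕ) : ℕ → ℤ → ℕ
  | 0 => f
  | t + 1 => lstep (ev f t)

theorem ev_spec (f : ℤ → ℕ) : IsLiarEvolution (ev f) := fun t j => lstep_spec (ev f t) j

noncomputable def lin (g : ℤ → ℝ) : ℕ → ℤ → ℝ
  | 0 => g
  | t + 1 => fun j => (lin g t (j - 1) + lin g t (j + 1)) / 2

theorem chi_congr (f f' : ℤ → ℕ) (h : ∀ j, Odd (f j) ↔ Odd (f' j)) :
    liarChi f = liarChi f' := by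
  funext j
  unfold liarChi
  simp only [h]

def Aop (h : ℤ → ℕ) : ℕ → ℤ → ℕ
  | 0 => h
  | t + 1 => fun j => Aop h t (j - 1) + Aop h t (j + 1)

theorem ev_add (f h : ℤ → ℕ) (T : ℕ) : ∀ t ≤ T, ∀ j,
    ev (fun x => f x + 2 ^ T * h x) t j = ev f t j + 2 ^ (T - t) * Aop h t j := by
  intro t
  induction t with
  | zero => intro _ j; simp [ev, Aop]
  | succ t ih =>
    intro ht j
    have ih' := ih (by omega)
    have e : T - t = (T - (t + 1)) + 1 := by omega
    have hc : liarChi (ev (fun x => f x + 2 ^ T * h x) t) = liarChi (ev f t) := by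
      apply chi_congr
      intro j
      rw [ih' j, e, pow_succ, Nat.odd_add]
      have : Even (2 ^ (T - (t + 1)) * 2 * Aop h t j) := by
        rw [mul_assoc]; exact (even_two_mul _).mul_left _
      simp only [this, iff_true]
    have h1 := ev_spec (fun x => f x + 2 ^ T * h x) t j
    have h2 := ev_spec f t j
    rw [hc, ih' (j - 1), ih' (j + 1), e, pow_succ] at h1
    push_cast at h1
    have : (ev (fun x => f x + 2 ^ T * h x) (t + 1) j : ℤ) =
      ev f (t + 1) j + 2 ^ (T - (t + 1)) * (Aop h t (j - 1) + Aop h t (j + 1)) := by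
      linarith
    simp only [Aop]
    exact_mod_cast this

theorem Aop_delta (y : ℤ) (t : ℕ) :
    (∀ x, x < y - t → Aop (fun x => if x = y then 1 else 0) t x = 0) ∧
    Aop (fun x => if x = y then 1 else 0) t (y - t) = 1 := by
  induction t with
  | zero =>
    constructor
    · intro x hx
      have : x ≠ y := by push_cast at hx; omega
      simp [Aop, this]
    · simp [Aop]
  | succ t ih =>
    obtain ⟨h1, h2⟩ := ih
    constructor
    · intro x hx
      push_cast at hx
      simp only [Aop]
      rw [h1 _ (by omega), h1 _ (by omega)]
    · simp only [Aop]
      push_cast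
      rw [h1 _ (by omega), show y - ((t : ℤ) + 1) + 1 = y - t by ring, h2]

theorem ev_zero (f : ℤ → ℕ) (m : ℤ) (hm : ∀ x < m, f x = 0) (t : ℕ) :
    ∀ x < m - t, ev f t x = 0 := by
  induction t with
  | zero => intro x hx; exact hm x (by push_cast at hx; omega)
  | succ t ih =>
    intro x hx
    push_cast at hx
    have h := ev_spec f t x
    have h1 := ih (x - 1) (by omega)
    have h2 := ih (x + 1) (by omega)
    have c1 := abs_le.mp (chi_abs_le (ev f t) (x - 1))
    have c2 := abs_le.mp (chi_abs_le (ev f t) (x + 1))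
    omega

theorem forcing (N : ℤ) (i : ℕ → ℤ) (T : ℕ) : ∃ f : ℤ → ℕ,
    (Function.support f).Finite ∧ (∃ m, ∀ x < m, f x = 0) ∧
    ∀ t < T, ∀ x ≤ N, (Odd (ev f t x) ↔ x = i t) := by
  induction T with
  | zero => exact ⟨fun _ => 0, by simp, ⟨0, by simp⟩, by simp⟩
  | succ T ih =>
    obtain ⟨f, hf, ⟨m, hm⟩, hT⟩ := ih
    obtain ⟨j0, hj1, hj2⟩ : ∃ j0 : ℤ, j0 < m - T ∧ j0 < i T :=
      ⟨min (m - T) (i T) - 1, by omega, by omega⟩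
    have key : ∀ n : ℕ, ∃ f : ℤ → ℕ,
        (Function.support f).Finite ∧ (∃ m, ∀ x < m, f x = 0) ∧
        (∀ t < T, ∀ x ≤ N, (Odd (ev f t x) ↔ x = i t)) ∧
        ∀ x ≤ j0 + n, (Odd (ev f T x) ↔ x = i T) := by
      intro n
      induction n with
      | zero =>
        refine ⟨f, hf, ⟨m, hm⟩, hT, ?_⟩
        intro x hx
        push_cast at hx
        rw [ev_zero f m hm T x (by omega)]
        have : x ≠ i T := by omega
        simp [this]
      | succ n ihn =>
        obtain ⟨f, hf, ⟨m, hm⟩, hT, hx⟩ := ihn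
        by_cases hc : Odd (ev f T (j0 + n + 1)) ↔ j0 + n + 1 = i T
        · refine ⟨f, hf, ⟨m, hm⟩, hT, ?_⟩
          intro x hx'
          push_cast at hx'
          rcases (show x ≤ j0 + n ∨ x = j0 + n + 1 by omega) with h | h
          · exact hx x h
          · rw [h]; exact hc
        · obtain ⟨y, hy⟩ : ∃ y : ℤ, y = j0 + n + 1 + T := ⟨_, rfl⟩
          have hA := Aop_delta y T
          have hadd := ev_add f (fun x => if x = y then 1 else 0) T
          refine ⟨fun x => f x + 2 ^ T * (if x = y then 1 else 0), ?_, ⟨min m y, ?_⟩, ?_, ?_⟩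
          · refine (hf.union (Set.finite_singleton y)).subset ?_
            intro x hx
            by_cases hxy : x = y
            · right; exact hxy
            · left; simpa [hxy] using hx
          · intro x hx
            have h1 : x ≠ y := by omega
            simp [h1, hm x (by omega)]
          · intro t ht x hxN
            rw [hadd t ht.le x, ← hT t ht x hxN, Nat.odd_add]
            have : Even (2 ^ (T - t) * Aop (fun x => if x = y then 1 else 0) t x) := by
              apply Even.mul_right
              exact (even_two).pow_of_ne_zero (by omega)
            simp only [this, iff_true]
          · intro x hx'
            push_cast at hx'
            rw [hadd T le_rfl x, Nat.sub_self, pow_zero, one_mul]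
            rcases (show x ≤ j0 + n ∨ x = j0 + n + 1 by omega) with h | h
            · rw [hA.1 x (by omega), add_zero]; exact hx x h
            · have h2 : x = y - T := by omega
              have h3 := hA.2
              rw [← h2] at h3
              rw [h3, h, Nat.odd_add_one]
              tauto
    obtain ⟨f, hf, hm, hT, hx⟩ := key (N - j0).toNat
    refine ⟨f, hf, hm, ?_⟩
    intro t ht x hxN
    rcases Nat.lt_succ_iff_lt_or_eq.mp ht with h | h
    · exact hT t h x hxN
    · subst h; exact hx x (by omega)

theorem chi_single (f : ℤ → ℕ) (N i : ℤ) (h : ∀ x ≤ N, (Odd (f x) ↔ x = i)) (x : ℤ)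
    (hx : x ≤ N) : liarChi f x = if x = i then 1 else 0 := by
  unfold liarChi
  simp only [h x hx]
  split_ifs with hi
  · have : {y : ℤ | y < x ∧ Odd (f y)} = ∅ := by
      ext y
      simp only [Set.mem_ofPred_eq, Set.mem_empty_iff_false, iff_false, not_and]
      intro hy ho
      have := (h y (by omega)).mp ho
      omega
    simp [this]
  · rfl

noncomputable def ker : ℕ → ℤ → ℝ := lin (fun x => if x = 0 then 1 else 0)

theorem ker_succ (s : ℕ) (x : ℤ) : ker (s + 1) x = (ker s (x - 1) + ker s (x + 1)) / 2 := rfl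

theorem err (f : ℤ → ℕ) (N : ℤ) (i : ℕ → ℤ) (T : ℕ)
    (h : ∀ t < T, ∀ x ≤ N, (Odd (ev f t x) ↔ x = i t)) : ∀ t ≤ T, ∀ j : ℤ, j ≤ N - t →
    (ev f t j : ℝ) - lin (fun x => (f x : ℝ)) t j =
      ∑ u ∈ Finset.range t,
        (ker (t - 1 - u) (j - 1 - i u) - ker (t - 1 - u) (j + 1 - i u)) / 2 := by
  intro t
  induction t with
  | zero => intro _ j _; simp [ev, lin]
  | succ t ih =>
    intro ht j hj
    push_cast at hj
    have i1 := ih (by omega) (j - 1) (by omega)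
    have i2 := ih (by omega) (j + 1) (by omega)
    have c1 := chi_single _ N (i t) (h t (by omega)) (j - 1) (by omega)
    have c2 := chi_single _ N (i t) (h t (by omega)) (j + 1) (by omega)
    have hs := ev_spec f t j
    have hs' : (ev f (t + 1) j : ℝ) * 2 = ev f t (j - 1) + ev f t (j + 1)
        + (liarChi (ev f t) (j - 1) : ℝ) - (liarChi (ev f t) (j + 1) : ℝ) := by
      exact_mod_cast hs
    rw [c1, c2] at hs'
    have hl : lin (fun x => (f x : ℝ)) (t + 1) j =
      (lin (fun x => (f x : ℝ)) t (j - 1) + lin (fun x => (f x : ℝ)) t (j + 1)) / 2 := rfl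
    rw [Finset.sum_range_succ]
    have k1 : ker (t + 1 - 1 - t) (j - 1 - i t) = if j - 1 = i t then 1 else 0 := by
      simp [ker, lin, sub_eq_zero]
    have k2 : ker (t + 1 - 1 - t) (j + 1 - i t) = if j + 1 = i t then 1 else 0 := by
      simp [ker, lin, sub_eq_zero]
    rw [k1, k2]
    have hsum : ∑ u ∈ Finset.range t,
        (ker (t + 1 - 1 - u) (j - 1 - i u) - ker (t + 1 - 1 - u) (j + 1 - i u)) / 2 =
        (∑ u ∈ Finset.range t,
        (ker (t - 1 - u) (j - 1 - 1 - i u) - ker (t - 1 - u) (j - 1 + 1 - i u)) / 2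
        + ∑ u ∈ Finset.range t,
        (ker (t - 1 - u) (j + 1 - 1 - i u) - ker (t - 1 - u) (j + 1 + 1 - i u)) / 2) / 2 := by
      rw [← Finset.sum_add_distrib, Finset.sum_div]
      apply Finset.sum_congr rfl
      intro u hu
      have hu' := Finset.mem_range.mp hu
      rw [show t + 1 - 1 - u = (t - 1 - u) + 1 by omega, ker_succ, ker_succ]
      rw [show j - 1 - i u - 1 = j - 1 - 1 - i u by ring,
        show j - 1 - i u + 1 = j - 1 + 1 - i u by ring,
        show j + 1 - i u - 1 = j + 1 - 1 - i u by ring,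
        show j + 1 - i u + 1 = j + 1 + 1 - i u by ring]
      ring
    rw [hsum, ← i1, ← i2, hl]
    push_cast at hs'
    linarith

noncomputable def q (s : ℕ) (x : ℤ) : ℝ := ker s x + ker s (x - 1)

theorem q_succ (s : ℕ) (x : ℤ) : q (s + 1) x = (q s (x - 1) + q s (x + 1)) / 2 := by
  unfold q
  rw [ker_succ, ker_succ, show x - 1 + 1 = x by ring, show x + 1 - 1 = x by ring]
  ring

theorem q_zero (x : ℤ) : q 0 x = if x = 0 ∨ x = 1 then 1 else 0 := by
  simp only [q, ker, lin]
  by_cases h0 : x = 0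
  · simp [h0]
  · by_cases h1 : x = 1
    · simp [h1]
    · have : x - 1 ≠ 0 := by omega
      simp [h0, h1, this]

theorem tele (s : ℕ) (a i : ℤ) (n : ℕ) :
    ∑ j ∈ Finset.Icc a (a + n), (ker s (j - 1 - i) - ker s (j + 1 - i)) / 2 =
      (q s (a - i) - q s (a + n + 1 - i)) / 2 := by
  induction n with
  | zero =>
    simp only [Nat.cast_zero, add_zero, Finset.Icc_self, Finset.sum_singleton, q]
    rw [show a - i - 1 = a - 1 - i by ring, show a + 1 - i - 1 = a - i by ring]
    ring
  | succ n ih =>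
    have : Finset.Icc a (a + ((n + 1 : ℕ) : ℤ)) =
        insert (a + n + 1) (Finset.Icc a (a + n)) := by
      ext x; simp only [Finset.mem_Icc, Finset.mem_insert]; push_cast; omega
    rw [this, Finset.sum_insert (by simp), ih]
    push_cast
    simp only [q]
    rw [show a + n + 1 - 1 - i = a + n + 1 - i - 1 by ring,
      show a + (n + 1 : ℤ) + 1 - i - 1 = a + n + 1 - i by ring,
      show a + (n + 1 : ℤ) + 1 - i = a + n + 1 + 1 - i by ring]
    ring

theorem q_symm (s : ℕ) : ∀ x, q s (1 - x) = q s x := by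
  induction s with
  | zero =>
    intro x
    rw [q_zero, q_zero]
    have : (1 - x = 0 ∨ 1 - x = 1) ↔ (x = 0 ∨ x = 1) := by omega
    simp only [this]
  | succ s ih =>
    intro x
    rw [q_succ, q_succ, ← ih (x - 1), ← ih (x + 1), show 1 - (x + 1) = 1 - x - 1 by ring,
      show 1 - (x - 1) = 1 - x + 1 by ring, add_comm]

theorem q_anti1 (s : ℕ) : ∀ x : ℤ, 0 ≤ x → q s (x + 1) ≤ q s x := by
  induction s with
  | zero =>
    intro x hx
    rw [q_zero, q_zero]
    split_ifs <;> first | omega | norm_num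
  | succ s ih =>
    intro x hx
    rcases (show x = 0 ∨ x = 1 ∨ 2 ≤ x by omega) with h | h | h
    · subst h
      have := q_symm (s + 1) 0
      norm_num at this ⊢
      exact this.le
    · subst h
      rw [q_succ, q_succ]
      have h1 := q_symm s 0
      have h2 := ih 2 (by norm_num)
      norm_num at h1 h2 ⊢
      linarith
    · rw [q_succ, q_succ]
      have h1 := ih (x - 1) (by omega)
      have h2 := ih (x + 1) (by omega)
      rw [show x + 1 - 1 = x - 1 + 1 by ring]
      linarith

theorem q_anti (s : ℕ) (x : ℤ) (hx : 0 ≤ x) (n : ℕ) : q s (x + n) ≤ q s x := by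
  induction n with
  | zero => simp
  | succ n ih =>
    have := q_anti1 s (x + n) (by omega)
    push_cast
    rw [← add_assoc]
    linarith

theorem q_sum (s : ℕ) : ∀ N : ℕ, ∑ n ∈ Finset.range N, q s (n + 1) ≤ 1 := by
  induction s with
  | zero =>
    intro N
    have : ∀ n : ℕ, q 0 ((n : ℤ) + 1) = if n = 0 then 1 else 0 := by
      intro n
      rw [q_zero]
      have : ((n : ℤ) + 1 = 0 ∨ (n : ℤ) + 1 = 1) ↔ n = 0 := by omega
      simp only [this]
    simp only [this, Finset.sum_ite_eq', Finset.mem_range]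
    split_ifs <;> norm_num
  | succ s ih =>
    intro N
    have step : ∀ N : ℕ, ∑ n ∈ Finset.range (N + 1), q (s + 1) (n + 1) =
        (∑ n ∈ Finset.range N, q s (n + 1) + ∑ n ∈ Finset.range (N + 2), q s (n + 1)) / 2 := by
      intro N
      induction N with
      | zero =>
        have h1 := q_symm s 0
        simp [Finset.sum_range_succ, q_succ]
        norm_num at h1 ⊢
        linarith
      | succ N ihN =>
        rw [Finset.sum_range_succ, ihN, Finset.sum_range_succ _ N,
          Finset.sum_range_succ _ (N + 2), q_succ]
        push_cast
        rw [show (N : ℤ) + 1 + 1 - 1 = N + 1 by ring,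
          show (N : ℤ) + 1 + 1 + 1 = N + 2 + 1 by ring]
        ring
    cases N with
    | zero => simp
    | succ N =>
      rw [step]
      linarith [ih N, ih (N + 2)]

theorem q_le (s : ℕ) (N : ℕ) : (N : ℝ) * q s N ≤ 1 := by
  refine le_trans ?_ (q_sum s N)
  have : ∑ n ∈ Finset.range N, q s N ≤ ∑ n ∈ Finset.range N, q s (n + 1) := by
    apply Finset.sum_le_sum
    intro n hn
    have hn' := Finset.mem_range.mp hn
    have := q_anti s (n + 1) (by omega) (N - (n + 1))
    rwa [show (n : ℤ) + 1 + ((N - (n + 1) : ℕ) : ℤ) = N by omega] at this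
  simpa using this

theorem q_binom (s : ℕ) : (∀ x : ℤ, x < -s → q s x = 0) ∧
    ∀ m : ℕ, q s (2 * m - s) = (s.choose m : ℝ) / 2 ^ s := by
  induction s with
  | zero =>
    constructor
    · intro x hx
      push_cast at hx
      rw [q_zero, if_neg (by omega)]
    · intro m
      rw [q_zero]
      cases m with
      | zero => simp
      | succ m => rw [if_neg (by push_cast; omega)]; simp
  | succ s ih =>
    obtain ⟨h1, h2⟩ := ih
    constructor
    · intro x hx
      push_cast at hx
      rw [q_succ, h1 _ (by omega), h1 _ (by omega)]; simp
    · intro m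
      rw [q_succ]
      push_cast
      rw [show 2 * (m : ℤ) - (s + 1) + 1 = 2 * m - s by ring, h2 m]
      cases m with
      | zero =>
        rw [h1 _ (by push_cast; omega)]
        simp [pow_succ]; ring
      | succ m =>
        have := h2 m
        push_cast
        rw [show 2 * ((m : ℤ) + 1) - (s + 1) - 1 = 2 * m - s by ring, this,
          Nat.choose_succ_succ, pow_succ]
        push_cast
        field_simp

theorem central (n : ℕ) (hn : 1 ≤ n) : (4 : ℝ) ^ n ≤ 2 * Real.sqrt n * n.centralBinom := by
  have key : ((4 : ℝ) ^ n) ^ 2 ≤ 4 * n * (n.centralBinom : ℝ) ^ 2 := by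
    induction n, hn using Nat.le_induction with
    | base => norm_num [Nat.centralBinom, Nat.choose]
    | succ n hn ih =>
      have h := Nat.succ_mul_centralBinom_succ n
      have h' : ((n : ℝ) + 1) * ((n + 1).centralBinom : ℝ) =
          2 * (2 * n + 1) * (n.centralBinom : ℝ) := by exact_mod_cast h
      have hn0 : (0 : ℝ) < n := by exact_mod_cast hn
      have e : ((n + 1).centralBinom : ℝ) = 2 * (2 * n + 1) * (n.centralBinom : ℝ) / (n + 1) := by
        field_simp; linarith
      rw [e, pow_succ (4 : ℝ) n, mul_pow]
      push_cast
      have : 4 * ((n : ℝ) + 1) * (2 * (2 * n + 1) * (n.centralBinom : ℝ) / (n + 1)) ^ 2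
        = 16 * (n.centralBinom : ℝ) ^ 2 * ((2 * n + 1) ^ 2 / (n + 1)) := by
        field_simp; ring
      rw [this]
      have h3 : 4 * (n : ℝ) ≤ (2 * n + 1) ^ 2 / (n + 1) := by
        rw [le_div_iff₀ (by positivity)]; nlinarith
      have h4 := mul_le_mul_of_nonneg_left h3
        (show (0 : ℝ) ≤ 16 * (n.centralBinom : ℝ) ^ 2 by positivity)
      nlinarith
  refine (pow_le_pow_iff_left₀ (by positivity) (by positivity) two_ne_zero).mp ?_
  rw [mul_pow, mul_pow, Real.sq_sqrt (by positivity)]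
  linarith

theorem q_mid (n : ℕ) (hn : 1 ≤ n) : 1 / (2 * Real.sqrt n) ≤ q (2 * n) 0 := by
  have h := (q_binom (2 * n)).2 n
  push_cast at h
  rw [sub_self] at h
  have hs : 0 < Real.sqrt n := Real.sqrt_pos.mpr (by exact_mod_cast hn)
  rw [h, pow_mul, div_le_div_iff₀ (by positivity) (by positivity)]
  have := central n hn
  norm_num
  rw [Nat.centralBinom] at this
  linarith

theorem pigeon (s D m : ℕ) (hm : 1 ≤ m) : ∃ k : ℕ,
    (q s 0 - q s ((m * D : ℕ) : ℤ)) / m ≤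
      q s ((k * D : ℕ) : ℤ) - q s (((k + 1) * D : ℕ) : ℤ) := by
  by_contra! hc
  have h1 := Finset.sum_range_sub' (fun k : ℕ => q s ((k * D : ℕ) : ℤ)) m
  have h2 : ∑ k ∈ Finset.range m, (q s ((k * D : ℕ) : ℤ) - q s (((k + 1) * D : ℕ) : ℤ)) <
      ∑ k ∈ Finset.range m, (q s 0 - q s ((m * D : ℕ) : ℤ)) / m :=
    Finset.sum_lt_sum_of_nonempty ⟨0, by simp; omega⟩ (fun k _ => hc k)
  rw [h1] at h2
  have hm' : (m : ℝ) ≠ 0 := by positivity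
  simp only [Finset.sum_const, Finset.card_range, nsmul_eq_mul, zero_mul, Nat.cast_zero] at h2
  rw [mul_div_cancel₀ _ hm'] at h2
  exact lt_irrefl _ h2

noncomputable def lw (D n : ℕ) : ℝ :=
  if n = 0 then 1 / 2 else D / (32 * n + 8 * Real.sqrt n * D)

theorem lw_exists (D n : ℕ) (hD : 2 ≤ D) : ∃ k : ℕ,
    lw D n ≤ (q (2 * n) (k : ℤ) - q (2 * n) ((k : ℤ) + D)) / 2 := by
  by_cases hn : n = 0
  · refine ⟨0, ?_⟩
    subst hn
    simp only [lw, if_true, mul_zero, q_zero]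
    rw [if_pos (by simp), if_neg (by push_cast; omega)]
    norm_num
  · have hn1 : 1 ≤ n := by omega
    have hs : 0 < Real.sqrt n := Real.sqrt_pos.mpr (by exact_mod_cast hn1)
    have hD0 : (0 : ℝ) < D := by positivity
    have hpos : 0 < 4 * Real.sqrt n / D := by positivity
    obtain ⟨m, hm⟩ : ∃ m, m = ⌈4 * Real.sqrt n / D⌉₊ := ⟨_, rfl⟩
    have hm1 : 1 ≤ m := by rw [hm]; exact Nat.ceil_pos.mpr hpos
    have hmle : 4 * Real.sqrt n / D ≤ m := by rw [hm]; exact Nat.le_ceil _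
    have hmlt : (m : ℝ) < 4 * Real.sqrt n / D + 1 := by rw [hm]; exact Nat.ceil_lt_add_one hpos.le
    obtain ⟨k, hk⟩ := pigeon (2 * n) D m hm1
    refine ⟨k * D, ?_⟩
    have e : ((k * D : ℕ) : ℤ) + D = (((k + 1) * D : ℕ) : ℤ) := by push_cast; ring
    rw [e]
    have hmid := q_mid n hn1
    have hN := q_le (2 * n) (m * D)
    have hND : 4 * Real.sqrt n ≤ ((m * D : ℕ) : ℝ) := by
      push_cast
      rwa [div_le_iff₀ hD0] at hmle
    have hqN : q (2 * n) ((m * D : ℕ) : ℤ) ≤ 1 / (4 * Real.sqrt n) := by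
      have : q (2 * n) ((m * D : ℕ) : ℤ) ≤ 1 / ((m * D : ℕ) : ℝ) := by
        rw [le_div_iff₀ (by linarith)]; linarith
      exact this.trans (one_div_le_one_div_of_le (by positivity) hND)
    have hm0 : (0 : ℝ) < m := by positivity
    have hdiff : 1 / (4 * Real.sqrt n) ≤ q (2 * n) 0 - q (2 * n) ((m * D : ℕ) : ℤ) := by
      have : 1 / (2 * Real.sqrt n) = 1 / (4 * Real.sqrt n) + 1 / (4 * Real.sqrt n) := by
        field_simp; norm_num
      linarith
    have h5 : 1 / (4 * Real.sqrt n) / (4 * Real.sqrt n / D + 1) ≤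
        (q (2 * n) 0 - q (2 * n) ((m * D : ℕ) : ℤ)) / m :=
      div_le_div₀ (le_trans (by positivity) hdiff) hdiff hm0 hmlt.le
    have h6 : lw D n = 1 / (4 * Real.sqrt n) / (4 * Real.sqrt n / D + 1) / 2 := by
      simp only [lw, if_neg hn]
      have hsq : (n : ℝ) = Real.sqrt n ^ 2 := (Real.sq_sqrt (by positivity)).symm
      generalize Real.sqrt n = r at *
      rw [hsq]
      field_simp
      ring
    rw [h6]
    linarith

theorem lw_nonneg (D n : ℕ) : 0 ≤ lw D n := by
  unfold lw
  split_ifs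
  · norm_num
  · positivity

theorem main_lower (T : ℕ) (a : ℤ) (B : ℕ) (hB : 1 ≤ B) : ∃ f : ℤ → ℕ,
    (Function.support f).Finite ∧
    ∑ n ∈ Finset.range ((T + 1) / 2), lw (B + 1) n ≤
      (∑ i ∈ Finset.Icc a (a + B), (ev f T i : ℝ)) -
        ∑ i ∈ Finset.Icc a (a + B), lin (fun x => (f x : ℝ)) T i := by
  have hex : ∀ s : ℕ, ∃ i : ℤ, (if s % 2 = 0 then lw (B + 1) (s / 2) else 0) ≤
      (q s (a - i) - q s (a + B + 1 - i)) / 2 := by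
    intro s
    split_ifs with h
    · obtain ⟨k, hk⟩ := lw_exists (B + 1) (s / 2) (by omega)
      rw [show 2 * (s / 2) = s by omega] at hk
      refine ⟨a - k, ?_⟩
      rw [show a - (a - (k : ℤ)) = k by ring,
        show a + B + 1 - (a - (k : ℤ)) = k + ((B + 1 : ℕ) : ℤ) by push_cast; ring]
      exact hk
    · refine ⟨a, ?_⟩
      have := q_anti s 0 le_rfl (B + 1)
      rw [sub_self, show a + B + 1 - a = 0 + ((B + 1 : ℕ) : ℤ) by push_cast; ring]
      linarith
  choose ι hι using hex
  obtain ⟨f, hf, -, hT⟩ := forcing (a + B + T) (fun t => ι (T - 1 - t)) T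
  refine ⟨f, hf, ?_⟩
  have herr := err f (a + B + T) (fun t => ι (T - 1 - t)) T hT T le_rfl
  rw [← Finset.sum_sub_distrib]
  have e1 : ∑ i ∈ Finset.Icc a (a + B), ((ev f T i : ℝ) - lin (fun x => (f x : ℝ)) T i) =
      ∑ s ∈ Finset.range T, (q s (a - ι s) - q s (a + B + 1 - ι s)) / 2 := by
    rw [← Finset.sum_range_reflect]
    rw [Finset.sum_congr rfl (fun j hj => herr j (by
      have := (Finset.mem_Icc.mp hj).2
      omega)), Finset.sum_comm]
    apply Finset.sum_congr rfl
    intro u _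
    exact tele (T - 1 - u) a (ι (T - 1 - u)) B
  rw [e1]
  refine le_trans ?_ (Finset.sum_le_sum (fun s _ => hι s))
  have e2 : ∑ n ∈ Finset.range ((T + 1) / 2), lw (B + 1) n =
      ∑ s ∈ (Finset.range ((T + 1) / 2)).image (fun n => 2 * n),
        (if s % 2 = 0 then lw (B + 1) (s / 2) else 0) := by
    rw [Finset.sum_image (by intro x _ y _ h; simpa using h)]
    apply Finset.sum_congr rfl
    intro n _
    simp
  rw [e2]
  apply Finset.sum_le_sum_of_subset_of_nonneg
  · intro s hs
    simp only [Finset.mem_image, Finset.mem_range] at hs ⊢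
    omega
  · intro s _ _
    split_ifs
    · exact lw_nonneg _ _
    · exact le_rfl

theorem bound1 (T B : ℕ) (hT : 2 ≤ T) (h : (B : ℝ) > Real.sqrt T / 2) :
    1 / 144 * Real.sqrt T ≤ ∑ n ∈ Finset.range ((T + 1) / 2), lw (B + 1) n := by
  have hT1 : (1 : ℝ) ≤ T := by exact_mod_cast (by omega : 1 ≤ T)
  have hs1 : 1 ≤ Real.sqrt T := Real.one_le_sqrt.mpr hT1
  have hterm : ∀ n ∈ Finset.range ((T + 1) / 2), 1 / (72 * Real.sqrt T) ≤ lw (B + 1) n := by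
    intro n hn
    have hn' := Finset.mem_range.mp hn
    unfold lw
    split_ifs with h0
    · apply one_div_le_one_div_of_le <;> linarith
    · have hnT : Real.sqrt n ≤ Real.sqrt T := Real.sqrt_le_sqrt (by exact_mod_cast (by omega))
      have hp : 0 < Real.sqrt n := Real.sqrt_pos.mpr (by positivity)
      have hsq : (n : ℝ) = Real.sqrt n ^ 2 := (Real.sq_sqrt (by positivity)).symm
      push_cast
      rw [div_le_div_iff₀ (by positivity) (by positivity)]
      rw [hsq, Real.sqrt_sq hp.le]
      generalize Real.sqrt n = r at *
      generalize Real.sqrt T = t at *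
      have hB : t ≤ 2 * ((B : ℝ) + 1) := by linarith
      nlinarith [mul_le_mul hnT (hnT.trans hB) hp.le (by linarith),
        mul_le_mul_of_nonneg_right hnT (show (0 : ℝ) ≤ B + 1 by positivity)]
  have h2 := Finset.card_nsmul_le_sum _ _ _ hterm
  refine le_trans ?_ h2
  rw [Finset.card_range, nsmul_eq_mul]
  have hc : (T : ℝ) / 2 ≤ (((T + 1) / 2 : ℕ) : ℝ) := by
    rw [div_le_iff₀ (by norm_num)]
    exact_mod_cast (by omega : T ≤ (T + 1) / 2 * 2)
  calc 1 / 144 * Real.sqrt T = (T : ℝ) / 2 * (1 / (72 * Real.sqrt T)) := by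
        have : (T : ℝ) = Real.sqrt T * Real.sqrt T := (Real.mul_self_sqrt (by positivity)).symm
        generalize Real.sqrt T = t at *
        rw [this]; field_simp; norm_num
    _ ≤ _ := by gcongr

theorem harm (M : ℕ) (hM : 1 ≤ M) (K : ℕ) (hK : M ≤ K) :
    Real.log ((K : ℝ) / M) ≤ ∑ n ∈ Finset.Ico M K, 1 / (n : ℝ) := by
  induction K, hK using Nat.le_induction with
  | base => simp
  | succ K hK ih =>
    rw [Finset.sum_Ico_succ_top hK]
    have hK0 : (0 : ℝ) < K := by exact_mod_cast (by omega)
    have hM0 : (0 : ℝ) < M := by exact_mod_cast (by omega)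
    have e : ((K + 1 : ℕ) : ℝ) / M = (K : ℝ) / M * (1 + 1 / K) := by
      push_cast; field_simp
    rw [e, Real.log_mul (by positivity) (by positivity)]
    have := Real.log_le_sub_one_of_pos (show (0 : ℝ) < 1 + 1 / K by positivity)
    linarith

theorem bound2 (T B : ℕ) (hB : 1 ≤ B) (h : (B : ℝ) ≤ Real.sqrt T / 2) :
    1 / 144 * B * Real.log ((T : ℝ) / (B : ℝ) ^ 2) ≤
      ∑ n ∈ Finset.range ((T + 1) / 2), lw (B + 1) n := by
  have hB1 : (1 : ℝ) ≤ B := by exact_mod_cast hB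
  have hT4 : 4 * (B : ℝ) ^ 2 ≤ T := by
    have h1 : (2 * (B : ℝ)) ≤ Real.sqrt T := by linarith
    have h2 := pow_le_pow_left₀ (by positivity) h1 2
    rw [Real.sq_sqrt (by positivity)] at h2
    linarith
  have hT4' : 4 * B ^ 2 ≤ T := by exact_mod_cast hT4
  have hT0 : (0 : ℝ) < T := by nlinarith
  obtain ⟨K, hK⟩ : ∃ K, K = (T + 1) / 2 := ⟨_, rfl⟩
  have hM : 1 ≤ B ^ 2 := Nat.one_le_pow _ _ hB
  have hMK : B ^ 2 ≤ K := by omega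
  have hharm := harm (B ^ 2) hM K hMK
  have hKT : (T : ℝ) / 2 ≤ K := by
    rw [div_le_iff₀ (by norm_num)]
    exact_mod_cast (by omega : T ≤ K * 2)
  have hlog : Real.log ((T : ℝ) / (B : ℝ) ^ 2) / 2 ≤ Real.log ((K : ℝ) / ((B ^ 2 : ℕ) : ℝ)) := by
    have h1 : Real.log ((T : ℝ) / (B : ℝ) ^ 2) ≤
        2 * Real.log ((K : ℝ) / ((B ^ 2 : ℕ) : ℝ)) := by
      rw [← Nat.cast_ofNat (R := ℝ) (n := 2), ← Real.log_pow]
      apply Real.log_le_log (by positivity)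
      push_cast
      have hx : 4 ≤ (T : ℝ) / (B : ℝ) ^ 2 := by
        rw [le_div_iff₀ (by positivity)]; exact hT4
      have hy : (T : ℝ) / (B : ℝ) ^ 2 / 2 ≤ (K : ℝ) / (B : ℝ) ^ 2 := by
        rw [div_right_comm]; gcongr
      generalize (T : ℝ) / (B : ℝ) ^ 2 = x at *
      generalize (K : ℝ) / (B : ℝ) ^ 2 = y at *
      nlinarith
    linarith
  have hlog0 : 0 ≤ Real.log ((T : ℝ) / (B : ℝ) ^ 2) := by
    apply Real.log_nonneg
    rw [le_div_iff₀ (by positivity)]; nlinarith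
  have hsum : (B : ℝ) / 48 * ∑ n ∈ Finset.Ico (B ^ 2) K, 1 / (n : ℝ) ≤
      ∑ n ∈ Finset.range K, lw (B + 1) n := by
    rw [Finset.mul_sum]
    refine le_trans (Finset.sum_le_sum (g := fun n => lw (B + 1) n) ?_)
      (Finset.sum_le_sum_of_subset_of_nonneg ?_ (fun n _ _ => lw_nonneg _ _))
    · intro n hn
      have hn' := (Finset.mem_Ico.mp hn).1
      have hn0 : n ≠ 0 := by omega
      simp only [lw, if_neg hn0]
      have hnp : (0 : ℝ) < n := by positivity
      have hBn : (B : ℝ) ≤ Real.sqrt n := Real.le_sqrt_of_sq_le (by exact_mod_cast hn')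
      have hsq : (n : ℝ) = Real.sqrt n ^ 2 := (Real.sq_sqrt (by positivity)).symm
      have hp : 0 < Real.sqrt n := Real.sqrt_pos.mpr hnp
      push_cast
      rw [div_mul_div_comm, mul_one, div_le_div_iff₀ (by positivity) (by positivity)]
      rw [hsq, Real.sqrt_sq hp.le]
      generalize Real.sqrt n = r at *
      have h1 : (B : ℝ) * (32 * r ^ 2 + 8 * r * (B + 1)) ≤ B * (48 * r ^ 2) := by
        gcongr
        nlinarith
      nlinarith [sq_nonneg r]
    · intro n hn
      have := Finset.mem_Ico.mp hn
      exact Finset.mem_range.mpr this.2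
  rw [← hK]
  refine le_trans ?_ hsum
  have h3 := hlog.trans hharm
  have h4 : (B : ℝ) / 48 * (Real.log ((T : ℝ) / (B : ℝ) ^ 2) / 2) ≤
      (B : ℝ) / 48 * ∑ n ∈ Finset.Ico (B ^ 2) K, 1 / (n : ℝ) := by gcongr
  have h5 : 0 ≤ (B : ℝ) * Real.log ((T : ℝ) / (B : ℝ) ^ 2) := by positivity
  nlinarith

end LiarAux

theorem liar_machine_interval_lower_bound :
    ∃ c : ℝ, 0 < c ∧ ∀ T : ℕ, 2 ≤ T → ∀ a b : ℤ, a < b →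
      ∃ (F : ℕ → ℤ → ℕ) (G : ℕ → ℤ → ℝ),
        (Function.support (F 0)).Finite ∧ IsLiarEvolution F ∧ IsLinearEvolution G ∧
        (∀ j : ℤ, G 0 j = (F 0 j : ℝ)) ∧
        (((b - a : ℤ) : ℝ) > Real.sqrt T / 2 →
          c * Real.sqrt T ≤
            |(∑ i ∈ Finset.Icc a b, (F T i : ℝ)) - ∑ i ∈ Finset.Icc a b, G T i|) ∧
        (((b - a : ℤ) : ℝ) ≤ Real.sqrt T / 2 →
          c * ((b - a : ℤ) : ℝ) * Real.log ((T : ℝ) / ((b - a : ℤ) : ℝ) ^ 2) ≤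
            |(∑ i ∈ Finset.Icc a b, (F T i : ℝ)) - ∑ i ∈ Finset.Icc a b, G T i|) := by
  refine ⟨1 / 144, by norm_num, ?_⟩
  intro T hT a b hab
  obtain ⟨B, hB⟩ : ∃ B : ℕ, b = a + B := ⟨(b - a).toNat, by omega⟩
  subst hB
  obtain ⟨f, hf, hlow⟩ := LiarAux.main_lower T a B (by omega)
  refine ⟨LiarAux.ev f, LiarAux.lin (fun x => (f x : ℝ)), hf, LiarAux.ev_spec f,
    fun _ _ => rfl, fun _ => rfl, ?_, ?_⟩
  · intro h
    rw [add_sub_cancel_left, Int.cast_natCast] at h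
    exact ((LiarAux.bound1 T B hT h).trans hlow).trans (le_abs_self _)
  · intro h
    rw [add_sub_cancel_left, Int.cast_natCast] at h ⊢
    exact ((LiarAux.bound2 T B (by omega) h).trans hlow).trans (le_abs_self _)
end

section
/- Let f ∈ (0,1/2), let n ≥ 1 be an integer, set F = ⌊fn⌋, and let n₃ be an integer with 0 ≤ n₃ ≤ F. Then Σ_{i=F−n₃}^{F} C(n,i) ≥ (1 − (f/(1−f))^{n₃} · (1−f)/(1−2f)) · Σ_{i=0}^{F} C(n,i), where C(n,i) denotes the binomial coefficient. -/
theorem btc_step (f : ℝ) (hf0 : 0 < f) (hf1 : f < 1 / 2) (n i : ℕ) (h : ((i : ℝ) + 1) ≤ f * n) :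
    (n.choose i : ℝ) ≤ f / (1 - f) * (n.choose (i + 1) : ℝ) := by
  have h1 : (0 : ℝ) < 1 - f := by linarith
  have hin : i ≤ n := by
    have h2 : (0 : ℝ) ≤ n := Nat.cast_nonneg n
    have : (i : ℝ) ≤ n := by nlinarith
    exact_mod_cast this
  have hc : (n.choose (i + 1) : ℝ) * ((i : ℝ) + 1) = n.choose i * ((n : ℝ) - i) := by
    have := Nat.choose_succ_right_eq n i
    rw [← Nat.cast_sub hin]
    exact_mod_cast this
  rw [div_mul_eq_mul_div, le_div_iff₀ h1]
  have hp : (0 : ℝ) < (i : ℝ) + 1 := by positivity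
  refine le_of_mul_le_mul_right ?_ hp
  have e : f * (n.choose (i + 1) : ℝ) * ((i : ℝ) + 1) = n.choose i * (f * ((n : ℝ) - i)) := by
    rw [mul_assoc, hc]; ring
  rw [e, mul_assoc]
  refine mul_le_mul_of_nonneg_left ?_ (Nat.cast_nonneg _)
  nlinarith

theorem btc_sum (f : ℝ) (hf0 : 0 < f) (hf1 : f < 1 / 2) (n k : ℕ) : ∀ m : ℕ,
    ((m : ℝ) + k ≤ f * n) →
    ∑ i ∈ Finset.range m, (n.choose i : ℝ) ≤
      (f / (1 - f)) ^ k * ∑ i ∈ Finset.range (m + k), (n.choose i : ℝ) := by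
  have hr : 0 ≤ f / (1 - f) := div_nonneg hf0.le (by linarith)
  induction k with
  | zero => intro m _; simp
  | succ k ih =>
    intro m hm
    push_cast at hm
    have h1 := ih (m + 1) (by push_cast; linarith)
    have h2 : ∑ i ∈ Finset.range m, (n.choose i : ℝ) ≤
        f / (1 - f) * ∑ i ∈ Finset.range (m + 1), (n.choose i : ℝ) := by
      rw [Finset.sum_range_succ', mul_add, Finset.mul_sum]
      have : ∑ i ∈ Finset.range m, (n.choose i : ℝ) ≤
          ∑ i ∈ Finset.range m, f / (1 - f) * (n.choose (i + 1) : ℝ) := by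
        refine Finset.sum_le_sum fun i hi => btc_step f hf0 hf1 n i ?_
        have : (i : ℝ) + 1 ≤ m := by exact_mod_cast Finset.mem_range.1 hi
        have : (0 : ℝ) ≤ k := Nat.cast_nonneg k
        linarith
      have : 0 ≤ f / (1 - f) * (n.choose 0 : ℝ) := by positivity
      linarith
    have h3 := mul_le_mul_of_nonneg_left h1 hr
    rw [show m + (k + 1) = m + 1 + k by ring, pow_succ', mul_assoc]
    exact h2.trans h3

theorem binomial_tail_cutoff (f : ℝ) (hf0 : 0 < f) (hf1 : f < 1 / 2)
    (n : ℕ) (hn : 1 ≤ n) (n₃ : ℕ) (hn₃ : n₃ ≤ ⌊f * n⌋₊) :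
    (1 - (f / (1 - f)) ^ n₃ * ((1 - f) / (1 - 2 * f))) *
        ∑ i ∈ Finset.range (⌊f * n⌋₊ + 1), (n.choose i : ℝ) ≤
      ∑ i ∈ Finset.Icc (⌊f * n⌋₊ - n₃) ⌊f * n⌋₊, (n.choose i : ℝ) := by
  have hF : ((⌊f * n⌋₊ : ℕ) : ℝ) ≤ f * n := Nat.floor_le (by positivity)
  generalize ⌊f * (n : ℝ)⌋₊ = F at *
  have hr : 0 ≤ f / (1 - f) := div_nonneg hf0.le (by linarith)
  have hs := btc_sum f hf0 hf1 n n₃ (F - n₃) (by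
    rw [Nat.cast_sub hn₃]; linarith)
  rw [Nat.sub_add_cancel hn₃] at hs
  have hsplit : ∑ i ∈ Finset.range (F - n₃), (n.choose i : ℝ) +
      ∑ i ∈ Finset.Icc (F - n₃) F, (n.choose i : ℝ) =
      ∑ i ∈ Finset.range (F + 1), (n.choose i : ℝ) := by
    have : Finset.Icc (F - n₃) F = Finset.Ico (F - n₃) (F + 1) := by
      ext; simp only [Finset.mem_Icc, Finset.mem_Ico]; omega
    rw [this]
    exact Finset.sum_range_add_sum_Ico _ (by omega)
  have hc : 1 ≤ (1 - f) / (1 - 2 * f) := by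
    rw [le_div_iff₀ (by linarith)]; linarith
  have hm : ∑ i ∈ Finset.range F, (n.choose i : ℝ) ≤
      (1 - f) / (1 - 2 * f) * ∑ i ∈ Finset.range (F + 1), (n.choose i : ℝ) := by
    have h0 : (0 : ℝ) ≤ ∑ i ∈ Finset.range (F + 1), (n.choose i : ℝ) := by positivity
    have h1 := le_mul_of_one_le_left h0 hc
    have h2 := Finset.sum_range_succ (fun i => (n.choose i : ℝ)) F
    have h3 : (0 : ℝ) ≤ n.choose F := Nat.cast_nonneg _
    linarith
  have h4 := mul_le_mul_of_nonneg_left hm (pow_nonneg hr n₃)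
  rw [sub_mul, one_mul, mul_assoc]
  linarith
end

section
/- Fix f ∈ (0,1/2) and for each integer n ≥ 3 set n₁ = n − ⌊(4/(1−2f)²)·log log n⌋ (natural logarithms). Then for every ε > 0 there exists N such that for all n ≥ N: (2^n / Σ_{i=0}^{⌊fn⌋} C(n,i)) · (C(n₁, ⌊f·n₁⌋) / 2^{n₁}) ≥ (log n)^{2−ε}. -/
theorem rcb_pinsker (f : ℝ) (hf0 : 0 < f) (hf1 : f < 1 / 2) :
    (1 - 2 * f) ^ 2 / 2 ≤ Real.log 2 + f * Real.log f + (1 - f) * Real.log (1 - f) := by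
  let g : ℝ → ℝ := fun x => Real.log 2 + x * Real.log x + (1 - x) * Real.log (1 - x)
    - (1 - 2 * x) ^ 2 / 2
  have hd : ∀ x ∈ Set.Icc f (1/2), HasDerivAt g (Real.log x - Real.log (1 - x) + 2 * (1 - 2 * x)) x := by
    intro x hx
    have hx0 : 0 < x := lt_of_lt_of_le hf0 hx.1
    have hx1 : 0 < 1 - x := by linarith [hx.2]
    have h1 := Real.hasDerivAt_log hx0.ne'
    have h2 : HasDerivAt (fun y : ℝ => 1 - y) (-1) x := by
      simpa using (hasDerivAt_id x).const_sub 1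
    have h3 := h2.log hx1.ne'
    have h4 : HasDerivAt (fun y : ℝ => 1 - 2 * y) (-2) x := by
      simpa using ((hasDerivAt_id x).const_mul 2).const_sub 1
    have h5 := ((((hasDerivAt_id x).mul h1).const_add (Real.log 2)).add (h2.mul h3)).sub
      ((h4.pow 2).div_const 2)
    refine (h5.congr_deriv ?_)
    simp only [id]
    field_simp
    push_cast
    ring
  have hanti : AntitoneOn g (Set.Icc f (1/2)) := by
    apply antitoneOn_of_deriv_nonpos (convex_Icc _ _)
    · intro x hx
      exact (hd x hx).continuousAt.continuousWithinAt
    · intro x hx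
      rw [interior_Icc] at hx
      exact (hd x ⟨hx.1.le, hx.2.le⟩).differentiableAt.differentiableWithinAt
    · intro x hx
      rw [interior_Icc] at hx
      rw [(hd x ⟨hx.1.le, hx.2.le⟩).deriv]
      have hx0 : 0 < x := lt_trans hf0 hx.1
      have hx1 : 0 < 1 - x := by linarith [hx.2]
      have h2 : 0 < 1 - 2 * x := by linarith [hx.2]
      have h := Real.le_log_one_add_of_nonneg (x := (1 - 2 * x) / x) (by positivity)
      have e1 : 2 * ((1 - 2 * x) / x) / ((1 - 2 * x) / x + 2) = 2 * (1 - 2 * x) := by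
        have : (1 - 2 * x) / x + 2 = 1 / x := by field_simp; ring
        rw [this]; field_simp
      have e2 : 1 + (1 - 2 * x) / x = (1 - x) / x := by field_simp; ring
      rw [e1, e2, Real.log_div hx1.ne' hx0.ne'] at h
      linarith
  have h := hanti (Set.left_mem_Icc.2 hf1.le) (Set.right_mem_Icc.2 hf1.le) hf1.le
  have h0 : g (1/2) = 0 := by
    simp only [g]
    have : Real.log (1/2) = - Real.log 2 := by rw [one_div, Real.log_inv]
    norm_num [this]
    ring
  rw [h0] at h
  simp only [g] at h
  linarith

theorem rcb_sum (f : ℝ) (hf0 : 0 < f) (hf1 : f < 1 / 2) (n k : ℕ) (hk : (k : ℝ) ≤ f * n) :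
    ∑ i ∈ Finset.range (k + 1), (n.choose i : ℝ) ≤ (1 - f) / (1 - 2 * f) * n.choose k := by
  have h2 : 0 < 1 - 2 * f := by linarith
  induction k with
  | zero =>
    simp
    rw [le_div_iff₀ h2]; linarith
  | succ k ih =>
    push_cast at hk
    have ih := ih (by linarith)
    rw [Finset.sum_range_succ]
    have hkn : k ≤ n := by
      have : (k : ℝ) ≤ n := by
        have : (0 : ℝ) ≤ n := Nat.cast_nonneg n
        nlinarith
      exact_mod_cast this
    have e : ((n.choose (k + 1) : ℕ) : ℝ) * (k + 1) = n.choose k * (n - k) := by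
      have := Nat.choose_succ_right_eq n k
      rw [← Nat.cast_sub hkn]
      exact_mod_cast this
    have hn : (0 : ℝ) < n := by
      by_contra h
      have : (0 : ℝ) ≤ n := Nat.cast_nonneg n
      have h3 : (0 : ℝ) ≤ k := Nat.cast_nonneg k
      nlinarith
    have hc : (n.choose k : ℝ) * (1 - f) ≤ n.choose (k + 1) * f := by
      have c0 : (0 : ℝ) ≤ n.choose k := Nat.cast_nonneg _
      have c1 : (0 : ℝ) ≤ n.choose (k + 1) := Nat.cast_nonneg _
      refine le_of_mul_le_mul_right ?_ hn
      calc (n.choose k : ℝ) * (1 - f) * n ≤ n.choose k * (n - k) := by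
            rw [mul_assoc]; gcongr; linarith
        _ = n.choose (k + 1) * (k + 1) := e.symm
        _ ≤ n.choose (k + 1) * f * n := by rw [mul_assoc]; gcongr
    have : (1 - f) / (1 - 2 * f) * (n.choose k : ℝ) ≤ f / (1 - 2 * f) * n.choose (k + 1) := by
      rw [div_mul_eq_mul_div, div_mul_eq_mul_div]
      gcongr ?_ / _
      linarith
    have e3 : (1 - f) / (1 - 2 * f) = f / (1 - 2 * f) + 1 := by
      rw [div_add_one h2.ne']; congr 1; ring
    calc _ ≤ f / (1 - 2 * f) * (n.choose (k + 1) : ℝ) + n.choose (k + 1) := by linarith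
      _ = _ := by rw [e3]; ring

noncomputable def rcbB (f : ℝ) (m : ℕ) : ℝ :=
  (m.choose ⌊f * m⌋₊ : ℝ) * (f / (1 - f)) ^ ⌊f * m⌋₊ * (1 - f) ^ m

theorem rcb_step (f : ℝ) (hf0 : 0 < f) (hf1 : f < 1 / 2) (m : ℕ) (T : ℝ) (hT : 0 < T)
    (hm : T + 1 ≤ f * (m + 1)) : rcbB f (m + 1) ≤ (1 + 1 / T) * rcbB f m := by
  have hf : 0 < 1 - f := by linarith
  have hm0 : (0 : ℝ) < m + 1 := by positivity
  have ha := Nat.floor_le (show 0 ≤ f * (m : ℝ) by positivity)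
  have hb := Nat.lt_floor_add_one (f * (m : ℝ))
  have ha' := Nat.floor_le (show 0 ≤ f * ((m + 1 : ℕ) : ℝ) by positivity)
  have hb' := Nat.lt_floor_add_one (f * ((m + 1 : ℕ) : ℝ))
  have hmono : ⌊f * (m : ℝ)⌋₊ ≤ ⌊f * ((m + 1 : ℕ) : ℝ)⌋₊ := by
    apply Nat.floor_mono; push_cast; nlinarith
  have hle : ⌊f * ((m + 1 : ℕ) : ℝ)⌋₊ < ⌊f * (m : ℝ)⌋₊ + 2 := by
    have : ((⌊f * ((m + 1 : ℕ) : ℝ)⌋₊ : ℕ) : ℝ) < (⌊f * (m : ℝ)⌋₊ : ℕ) + 2 := by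
      push_cast at ha' ⊢; nlinarith
    exact_mod_cast this
  unfold rcbB
  generalize ⌊f * (m : ℝ)⌋₊ = k at *
  generalize ⌊f * ((m + 1 : ℕ) : ℝ)⌋₊ = k' at *
  push_cast at ha' hb'
  have hr : 0 < f / (1 - f) := by positivity
  have hcases : k' = k ∨ k' = k + 1 := by omega
  rcases hcases with rfl | rfl
  · have hkm : k' ≤ m + 1 := by
      have : (k' : ℝ) ≤ m + 1 := by nlinarith
      exact_mod_cast this
    have e : (m.choose k' : ℝ) * (m + 1) = (m + 1).choose k' * (m + 1 - k') := by
      have := Nat.choose_mul_succ_eq m k'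
      have h2 : ((m + 1 - k' : ℕ) : ℝ) = m + 1 - k' := by rw [Nat.cast_sub hkm]; push_cast; ring
      rw [← h2]; exact_mod_cast this
    have c0 : (0 : ℝ) ≤ m.choose k' := Nat.cast_nonneg _
    have h : ((m + 1).choose k' : ℝ) * (1 - f) ≤ m.choose k' := by
      refine le_of_mul_le_mul_right ?_ hm0
      rw [e, mul_assoc]
      gcongr
      linarith
    have h' : (m.choose k' : ℝ) ≤ (1 + 1 / T) * m.choose k' := by
      have : 0 ≤ 1 / T * (m.choose k' : ℝ) := by positivity
      linarith
    calc _ = ((m + 1).choose k' : ℝ) * (1 - f) * ((f / (1 - f)) ^ k' * (1 - f) ^ m) := by ring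
      _ ≤ (1 + 1 / T) * m.choose k' * ((f / (1 - f)) ^ k' * (1 - f) ^ m) := by
        exact mul_le_mul_of_nonneg_right (h.trans h') (by positivity)
      _ = _ := by ring
  · have e : ((m : ℝ) + 1) * m.choose k = (m + 1).choose (k + 1) * (k + 1) := by
      have := Nat.add_one_mul_choose_eq m k
      exact_mod_cast this
    push_cast at ha' hb'
    have h1 : f * (m + 1) ≤ (1 + 1 / T) * (k + 1) := by
      have : 1 ≤ 1 / T * ((k : ℝ) + 1) := by
        rw [div_mul_eq_mul_div, le_div_iff₀ hT]; linarith
      linarith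
    have h : ((m + 1).choose (k + 1) : ℝ) * f ≤ (1 + 1 / T) * m.choose k := by
      refine le_of_mul_le_mul_right ?_ hm0
      calc ((m + 1).choose (k + 1) : ℝ) * f * (m + 1)
          = ((m + 1).choose (k + 1) : ℝ) * (f * (m + 1)) := by ring
        _ ≤ ((m + 1).choose (k + 1) : ℝ) * ((1 + 1 / T) * (k + 1)) := by gcongr
        _ = (1 + 1 / T) * (((m + 1).choose (k + 1) : ℝ) * (k + 1)) := by ring
        _ = _ := by rw [← e]; ring
    calc _ = ((m + 1).choose (k + 1) : ℝ) * f * ((f / (1 - f)) ^ k * (1 - f) ^ m) := by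
          rw [pow_succ, pow_succ]; field_simp
      _ ≤ (1 + 1 / T) * m.choose k * ((f / (1 - f)) ^ k * (1 - f) ^ m) := by
        gcongr
      _ = _ := by ring

theorem rcb_iter (f : ℝ) (hf0 : 0 < f) (hf1 : f < 1 / 2) (m : ℕ) (T : ℝ) (hT : 0 < T)
    (hm : T + 1 ≤ f * (m + 1)) (d : ℕ) : rcbB f (m + d) ≤ (1 + 1 / T) ^ d * rcbB f m := by
  induction d with
  | zero => simp
  | succ d ih =>
    have h := rcb_step f hf0 hf1 (m + d) T hT (by
      push_cast
      have : (0 : ℝ) ≤ d := Nat.cast_nonneg d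
      nlinarith)
    calc _ ≤ (1 + 1 / T) * rcbB f (m + d) := h
      _ ≤ (1 + 1 / T) * ((1 + 1 / T) ^ d * rcbB f m) := by gcongr
      _ = _ := by ring

/-- Nonasymptotic bound. -/
theorem rcb_main (f : ℝ) (hf0 : 0 < f) (hf1 : f < 1 / 2) (m d : ℕ)
    (hm : (d : ℝ) + 2 ≤ f * (m + 1)) :
    (1 - 2 * f) / (1 - f) * (f / (1 - f)) * Real.exp (-1) * Real.exp ((1 - 2 * f) ^ 2 / 2 * d) ≤
    ((2 : ℝ) ^ (m + d) / ∑ i ∈ Finset.range (⌊f * ((m + d : ℕ) : ℝ)⌋₊ + 1), ((m + d).choose i : ℝ)) *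
          ((m.choose ⌊f * m⌋₊ : ℝ) / 2 ^ m) := by
  have hf : 0 < 1 - f := by linarith
  have hf2 : 0 < 1 - 2 * f := by linarith
  have hT : (0 : ℝ) < d + 1 := by positivity
  have hB := rcb_iter f hf0 hf1 m (d + 1) hT (by linarith) d
  have hE : (1 + 1 / ((d : ℝ) + 1)) ^ d ≤ Real.exp 1 := by
    calc (1 + 1 / ((d : ℝ) + 1)) ^ d ≤ (Real.exp (1 / ((d : ℝ) + 1))) ^ d := by
          gcongr
          linarith [Real.add_one_le_exp (1 / ((d : ℝ) + 1))]
      _ = Real.exp (d * (1 / ((d : ℝ) + 1))) := by rw [← Real.exp_nat_mul]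
      _ ≤ _ := by
        apply Real.exp_le_exp.2
        rw [mul_one_div, div_le_one hT]; linarith
  have ha := Nat.floor_le (show 0 ≤ f * (m : ℝ) by positivity)
  have hb := Nat.lt_floor_add_one (f * (m : ℝ))
  have ha' := Nat.floor_le (show 0 ≤ f * ((m + d : ℕ) : ℝ) by positivity)
  have hmono : ⌊f * (m : ℝ)⌋₊ ≤ ⌊f * ((m + d : ℕ) : ℝ)⌋₊ := by
    apply Nat.floor_mono; push_cast
    have : (0 : ℝ) ≤ d := Nat.cast_nonneg d
    nlinarith
  have hS := rcb_sum f hf0 hf1 (m + d) _ ha'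
  unfold rcbB at hB
  generalize ⌊f * (m : ℝ)⌋₊ = k at *
  generalize ⌊f * ((m + d : ℕ) : ℝ)⌋₊ = k' at *
  obtain ⟨j, rfl⟩ := Nat.exists_eq_add_of_le hmono
  push_cast at ha'
  have hj : (j : ℝ) ≤ f * d + 1 := by linarith
  have hSpos : 0 < ∑ i ∈ Finset.range (k + j + 1), ((m + d).choose i : ℝ) := by
    rw [Finset.sum_range_succ']
    simp only [Nat.choose_zero_right, Nat.cast_one]
    positivity
  generalize ∑ i ∈ Finset.range (k + j + 1), ((m + d).choose i : ℝ) = S at *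
  set r := f / (1 - f) with hrdef
  have hr : 0 < r := by positivity
  have hr1 : r < 1 := by rw [hrdef, div_lt_one hf]; linarith
  have hlr : Real.log r ≤ 0 := Real.log_nonpos hr.le hr1.le
  have key : ((m + d).choose (k + j) : ℝ) * (r ^ j * (1 - f) ^ d) ≤ Real.exp 1 * m.choose k := by
    have hp : 0 < r ^ k * (1 - f) ^ m := by positivity
    refine le_of_mul_le_mul_right ?_ hp
    calc _ = ((m + d).choose (k + j) : ℝ) * r ^ (k + j) * (1 - f) ^ (m + d) := by ring
      _ ≤ _ := hB
      _ ≤ Real.exp 1 * (m.choose k * r ^ k * (1 - f) ^ m) := by gcongr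
      _ = _ := by ring
  have hpin := rcb_pinsker f hf0 hf1
  -- lower bound on the tilt factor
  have hexp : r * Real.exp ((1 - 2 * f) ^ 2 / 2 * d) ≤ 2 ^ d * (r ^ j * (1 - f) ^ d) := by
    have e1 : (2 : ℝ) ^ d = Real.exp (d * Real.log 2) := by
      rw [Real.exp_nat_mul, Real.exp_log (by norm_num)]
    have e2 : r ^ j = Real.exp (j * Real.log r) := by
      rw [Real.exp_nat_mul, Real.exp_log hr]
    have e3 : (1 - f) ^ d = Real.exp (d * Real.log (1 - f)) := by
      rw [Real.exp_nat_mul, Real.exp_log hf]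
    rw [e1, e2, e3, ← Real.exp_add, ← Real.exp_add]
    nth_rewrite 1 [← Real.exp_log hr]
    rw [← Real.exp_add]
    apply Real.exp_le_exp.2
    have h1 : (f * d + 1) * Real.log r ≤ j * Real.log r :=
      mul_le_mul_of_nonpos_right hj hlr
    have h2 : Real.log r = Real.log f - Real.log (1 - f) := Real.log_div hf0.ne' hf.ne'
    have h3 := mul_le_mul_of_nonneg_right hpin (Nat.cast_nonneg (α := ℝ) d)
    have h4 : (f * d + 1) * Real.log r = Real.log r + f * d * (Real.log f - Real.log (1 - f)) := by
      rw [← h2]; ring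
    linarith
  have e0 : (2 : ℝ) ^ (m + d) / S * ((m.choose k : ℝ) / 2 ^ m) = 2 ^ d * m.choose k / S := by
    rw [pow_add]; field_simp
  rw [e0, le_div_iff₀ hSpos]
  have c0 : (0 : ℝ) ≤ (m + d).choose (k + j) := Nat.cast_nonneg _
  calc _ ≤ (1 - 2 * f) / (1 - f) * r * Real.exp (-1) * Real.exp ((1 - 2 * f) ^ 2 / 2 * d) *
        ((1 - f) / (1 - 2 * f) * ((m + d).choose (k + j) : ℝ)) := by gcongr
    _ = Real.exp (-1) * ((m + d).choose (k + j) : ℝ) * (r * Real.exp ((1 - 2 * f) ^ 2 / 2 * d)) := by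
      field_simp
    _ ≤ Real.exp (-1) * ((m + d).choose (k + j) : ℝ) * (2 ^ d * (r ^ j * (1 - f) ^ d)) := by gcongr
    _ = Real.exp (-1) * 2 ^ d * (((m + d).choose (k + j) : ℝ) * (r ^ j * (1 - f) ^ d)) := by ring
    _ ≤ Real.exp (-1) * 2 ^ d * (Real.exp 1 * m.choose k) := by gcongr
    _ = (Real.exp (-1) * Real.exp 1) * (2 ^ d * m.choose k) := by ring
    _ = _ := by rw [← Real.exp_add]; simp

theorem relative_cdf_bound (f : ℝ) (hf0 : 0 < f) (hf1 : f < 1 / 2) :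
    ∀ ε : ℝ, 0 < ε → ∃ N : ℕ, ∀ n : ℕ, N ≤ n →
      let n₁ := n - ⌊(4 / (1 - 2 * f) ^ 2) * Real.log (Real.log n)⌋₊
      ((2 : ℝ) ^ n / ∑ i ∈ Finset.range (⌊f * n⌋₊ + 1), (n.choose i : ℝ)) *
          ((n₁.choose ⌊f * n₁⌋₊ : ℝ) / 2 ^ n₁) ≥
        Real.log n ^ ((2 : ℝ) - ε) := by
  intro ε hε
  have hf : 0 < 1 - f := by linarith
  have hf2 : 0 < 1 - 2 * f := by linarith
  set A := 4 / (1 - 2 * f) ^ 2 with hA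
  have hA0 : 0 < A := by positivity
  set c := (1 - 2 * f) / (1 - f) * (f / (1 - f)) * Real.exp (-1) with hc
  have hc0 : 0 < c := by positivity
  have hcast := tendsto_natCast_atTop_atTop (R := ℝ)
  have hlog : Filter.Tendsto (fun n : ℕ => Real.log (n : ℝ)) Filter.atTop Filter.atTop :=
    Real.tendsto_log_atTop.comp hcast
  have hll : Filter.Tendsto (fun n : ℕ => Real.log (Real.log (n : ℝ))) Filter.atTop Filter.atTop :=
    Real.tendsto_log_atTop.comp hlog
  have hε' := hll.const_mul_atTop hε
  have hlo : ∀ᶠ n : ℕ in Filter.atTop, ‖Real.log (n : ℝ)‖ ≤ (f / (4 * A)) * ‖((n : ℕ) : ℝ)‖ :=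
    hcast.eventually (Real.isLittleO_log_id_atTop.def (show 0 < f / (4 * A) by positivity))
  have hev := (((hlog.eventually_gt_atTop 0).and (hll.eventually_ge_atTop 0)).and
    (hε'.eventually_ge_atTop (1 / 2 - Real.log c))).and
    (hlo.and (hcast.eventually_ge_atTop (4 / f)))
  obtain ⟨N, hN⟩ := Filter.eventually_atTop.1 hev
  refine ⟨N, fun n hn => ?_⟩
  obtain ⟨⟨⟨h1, h2⟩, h3⟩, h4, h5⟩ := hN n hn
  intro n₁
  have hd1 := Nat.floor_le (mul_nonneg hA0.le h2)
  have hd2 := Nat.lt_floor_add_one (A * Real.log (Real.log n))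
  have hn₁ : n₁ = n - ⌊A * Real.log (Real.log n)⌋₊ := rfl
  clear_value n₁
  generalize ⌊A * Real.log (Real.log n)⌋₊ = d at *
  rw [Real.norm_of_nonneg h1.le, Real.norm_of_nonneg (Nat.cast_nonneg n)] at h4
  have h6 : Real.log (Real.log n) ≤ Real.log n := by
    linarith [Real.log_le_sub_one_of_pos h1]
  have h7 : (d : ℝ) ≤ f / 4 * n := by
    calc (d : ℝ) ≤ A * Real.log (Real.log n) := hd1
      _ ≤ A * (f / (4 * A) * n) := by gcongr; linarith
      _ = _ := by field_simp
  have h8 : 4 ≤ f * n := by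
    rw [div_le_iff₀ hf0] at h5; linarith
  have hnn : (0 : ℝ) ≤ n := Nat.cast_nonneg n
  have hdn : d ≤ n := by
    have : (d : ℝ) ≤ n := by nlinarith
    exact_mod_cast this
  have hnd : n = n₁ + d := by omega
  have hmd : (n : ℝ) = n₁ + d := by exact_mod_cast hnd
  have hd0 : (0 : ℝ) ≤ d := Nat.cast_nonneg d
  have hmain := rcb_main f hf0 hf1 n₁ d (by
    have : (n₁ : ℝ) = n - d := by linarith
    rw [this]
    nlinarith)
  rw [← hnd] at hmain
  refine le_trans ?_ hmain
  rw [Real.rpow_def_of_pos h1, ← hc]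
  nth_rewrite 1 [← Real.exp_log hc0]
  rw [← Real.exp_add]
  apply Real.exp_le_exp.2
  have h9 : (1 - 2 * f) ^ 2 / 2 * (A * Real.log (Real.log n)) ≤ (1 - 2 * f) ^ 2 / 2 * (d + 1) := by
    gcongr
  have h10 : (1 - 2 * f) ^ 2 / 2 * (A * Real.log (Real.log n)) = 2 * Real.log (Real.log n) := by
    rw [hA]; field_simp; norm_num
  have h11 : (1 - 2 * f) ^ 2 / 2 ≤ 1 / 2 := by nlinarith
  rw [h10] at h9
  linarith
end

section
/- For every f ∈ (0,1/2), (4·log 2/(1−2f)²)·(1 − H(f)) > 2, where H(x) = −x·log₂ x − (1−x)·log₂(1−x) is the binary entropy function and log denotes the natural logarithm. -/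
/-- The binary entropy function `H(x) = -x log₂ x - (1-x) log₂ (1-x)`. -/
noncomputable def binaryEntropy (x : ℝ) : ℝ :=
  -(x * Real.logb 2 x) - (1 - x) * Real.logb 2 (1 - x)

theorem aux_deriv_neg (x : ℝ) (h0 : 0 < x) (h1 : x < 1 / 2) :
    Real.log x - Real.log (1 - x) + 2 * (1 - 2 * x) < 0 := by
  have h := Real.sum_range_le_log_div (x := 1 - 2 * x) (by linarith) (by linarith) 2
  have e : (1 + (1 - 2 * x)) / (1 - (1 - 2 * x)) = (1 - x) / x := by
    have : (1 - (1 - 2 * x)) ≠ 0 := by linarith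
    field_simp
    ring
  rw [e, Real.log_div (by linarith) (by linarith)] at h
  norm_num [Finset.sum_range_succ] at h
  have : 0 < (1 - 2 * x) ^ 3 := pow_pos (by linarith) 3
  linarith

theorem aux_main (f : ℝ) (hf0 : 0 < f) (hf1 : f < 1 / 2) :
    (1 - 2 * f) ^ 2 / 2 < Real.log 2 + f * Real.log f + (1 - f) * Real.log (1 - f) := by
  let g : ℝ → ℝ := fun x =>
    x * Real.log x + (1 - x) * Real.log (1 - x) - (1 - 2 * x) ^ 2 / 2
  have hd : ∀ x : ℝ, 0 < x → x < 1 →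
      HasDerivAt g (Real.log x - Real.log (1 - x) + 2 * (1 - 2 * x)) x := by
    intro x h0 h1
    have hs : HasDerivAt (fun x : ℝ => 1 - x) (-1) x := by
      simpa using (hasDerivAt_id x).const_sub 1
    have h2 : HasDerivAt (fun x : ℝ => 1 - 2 * x) (-2) x := by
      simpa using ((hasDerivAt_id x).const_mul 2).const_sub 1
    have hx : x ≠ 0 := h0.ne'
    have hx1 : 1 - x ≠ 0 := by linarith
    have := (((hasDerivAt_id x).mul (Real.hasDerivAt_log hx)).add
      (hs.mul (hs.log hx1))).sub ((h2.pow 2).div_const 2)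
    refine this.congr_deriv ?_
    simp only [id]
    field_simp
    ring
  have ha : StrictAntiOn g (Set.Icc f (1 / 2)) := by
    apply strictAntiOn_of_deriv_neg (convex_Icc _ _)
    · intro x hx
      exact (hd x (by linarith [hx.1]) (by linarith [hx.2])).continuousAt.continuousWithinAt
    · intro x hx
      rw [interior_Icc] at hx
      rw [(hd x (by linarith [hx.1]) (by linarith [hx.2])).deriv]
      exact aux_deriv_neg x (by linarith [hx.1]) hx.2
  have := ha (Set.left_mem_Icc.2 hf1.le) (Set.right_mem_Icc.2 hf1.le) hf1
  simp only [g] at this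
  have e : (1 : ℝ) - 1 / 2 = 1 / 2 := by norm_num
  have l : Real.log (1 / 2) = -Real.log 2 := by rw [one_div, Real.log_inv]
  rw [e, l] at this
  linarith

theorem entropy_exponent_gt_two (f : ℝ) (hf0 : 0 < f) (hf1 : f < 1 / 2) :
    2 < (4 * Real.log 2 / (1 - 2 * f) ^ 2) * (1 - binaryEntropy f) := by
  have h := aux_main f hf0 hf1
  have hl : 0 < Real.log 2 := Real.log_pos (by norm_num)
  have ht : 0 < (1 - 2 * f) ^ 2 := pow_pos (by linarith) 2
  have e : (4 * Real.log 2 / (1 - 2 * f) ^ 2) * (1 - binaryEntropy f) =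
      4 * (Real.log 2 + f * Real.log f + (1 - f) * Real.log (1 - f)) / (1 - 2 * f) ^ 2 := by
    unfold binaryEntropy Real.logb
    have := hl.ne'
    rw [div_mul_eq_mul_div]
    congr 1
    field_simp
    ring
  rw [e, lt_div_iff₀ ht]
  linarith
end
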